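/- arXiv:2303.00106 — 8 statements merged into one kernel-verified Lean document; each statement's English description precedes it below -/
import Mathlib

section
/- Contrastive learning with the linear loss ℓ(t) = −t is generalized nonlinear PCA on the conditional-mean representation: defining φ̄(r) = ∫_{Ω_U} h(r,u) dμ_U(u) and φ̄₀ = ∫_{Ω_R} φ̄(r) dμ_R(r), one has ∫ ℓ(⟪h(r,u), h(r,u') − h(r'',u'')⟫) d(μ_R ⊗ μ_U ⊗ μ_U ⊗ μ_R ⊗ μ_U)(r,u,u',r'',u'') = − ∫_{Ω_R} ‖φ̄(r) − φ̄₀‖² dμ_R(r). -/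
open MeasureTheory ProbabilityTheory
open scoped RealInnerProductSpace

/-- The variance of `f` is the integral of its inner product with the centred function. -/
theorem integral_inner_sub_integral_self {α E : Type*} [MeasurableSpace α]
    [NormedAddCommGroup E] [InnerProductSpace ℝ E] [CompleteSpace E]
    {μ : Measure α} [IsProbabilityMeasure μ] {f : α → E} (hf : MemLp f 2 μ) :
    ∫ x, ⟪f x, f x - ∫ y, f y ∂μ⟫ ∂μ = ∫ x, ‖f x - ∫ y, f y ∂μ‖ ^ 2 ∂μ := by
  set m := ∫ y, f y ∂μ with hm
  have hf1 : Integrable f μ := hf.integrable one_le_two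
  have hc : Integrable (fun x => f x - m) μ := hf1.sub (integrable_const m)
  have hsq : Integrable (fun x => ‖f x - m‖ ^ 2) μ := (hf.sub (memLp_const m)).integrable_norm_pow
    two_ne_zero
  calc ∫ x, ⟪f x, f x - m⟫ ∂μ = ∫ x, (‖f x - m‖ ^ 2 + ⟪m, f x - m⟫) ∂μ := by
        refine integral_congr_ae (.of_forall fun x => ?_)
        simp only [← real_inner_self_eq_norm_sq, ← inner_add_left, sub_add_cancel]
    _ = ∫ x, ‖f x - m‖ ^ 2 ∂μ := by
        rw [integral_add hsq (hc.const_inner m), integral_inner hc,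
          integral_sub hf1 (integrable_const m)]
        simp [← hm]

/-- Contrastive learning with the linear loss `ℓ(t) = -t` is generalized nonlinear PCA on the
conditional-mean representation. -/
theorem stmt_0
    {ΩR ΩU : Type*} [MeasurableSpace ΩR] [MeasurableSpace ΩU]
    (μR : Measure ΩR) (μU : Measure ΩU)
    [IsProbabilityMeasure μR] [IsProbabilityMeasure μU]
    {k : ℕ} (hk : 1 ≤ k)
    (h : ΩR × ΩU → EuclideanSpace ℝ (Fin k))
    (hmeas : Measurable h)
    (C : ℝ) (hbdd : ∀ p, ‖h p‖ ≤ C)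
    (ℓ : ℝ → ℝ) (hℓ : ∀ t, ℓ t = -t)
    (φbar : ΩR → EuclideanSpace ℝ (Fin k))
    (hφbar : ∀ r, φbar r = ∫ u, h (r, u) ∂μU)
    (φ0 : EuclideanSpace ℝ (Fin k))
    (hφ0 : φ0 = ∫ r, φbar r ∂μR) :
    (∫ q : ΩR × ΩU × ΩU × ΩR × ΩU,
        ℓ ⟪h (q.1, q.2.1), h (q.1, q.2.2.1) - h (q.2.2.2.1, q.2.2.2.2)⟫
        ∂(μR.prod (μU.prod (μU.prod (μR.prod μU)))))
      = - ∫ r, ‖φbar r - φ0‖ ^ 2 ∂μR := by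
  have hint : Integrable h (μR.prod μU) :=
    .of_bound hmeas.aestronglyMeasurable C (.of_forall hbdd)
  have hsec (r : ΩR) : Integrable (fun u => h (r, u)) μU :=
    .of_bound (hmeas.comp measurable_prodMk_left).aestronglyMeasurable C (.of_forall fun _ => hbdd _)
  obtain rfl : φbar = fun r => ∫ u, h (r, u) ∂μU := funext hφbar
  have hφ : MemLp (fun r => ∫ u, h (r, u) ∂μU) 2 μR := by
    refine .of_bound hmeas.stronglyMeasurable.integral_prod_right'.aestronglyMeasurable C
      (.of_forall fun r => ?_)
    simpa using norm_integral_le_of_norm_le_const (μ := μU) (.of_forall fun u => hbdd (r, u))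
  have hmean : φ0 = ∫ p, h p ∂μR.prod μU := hφ0.trans (integral_prod _ hint).symm
  have hloss : Integrable (fun q : ΩR × ΩU × ΩU × ΩR × ΩU =>
      ⟪h (q.1, q.2.1), h (q.1, q.2.2.1) - h (q.2.2.2.1, q.2.2.2.2)⟫)
      (μR.prod (μU.prod (μU.prod (μR.prod μU)))) := by
    refine .of_bound (by fun_prop) (C * (C + C)) (.of_forall fun q => ?_)
    refine (norm_inner_le_norm _ _).trans ?_
    exact mul_le_mul (hbdd _) ((norm_sub_le _ _).trans (add_le_add (hbdd _) (hbdd _)))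
      (norm_nonneg _) ((norm_nonneg _).trans (hbdd (q.1, q.2.1)))
  have hcond (r : ΩR) :
      ∫ z : ΩU × ΩU × ΩR × ΩU, ⟪h (r, z.1), h (r, z.2.1) - h (z.2.2.1, z.2.2.2)⟫
        ∂μU.prod (μU.prod (μR.prod μU)) = ⟪∫ u, h (r, u) ∂μU, (∫ u, h (r, u) ∂μU) - φ0⟫ := by
    have hpos := (hsec r).comp_fst (μR.prod μU)
    have hneg := hint.comp_snd μU
    refine (integral_prod_bilin (innerSL ℝ) (hsec r) (hpos.sub hneg)).trans
      (congrArg (inner ℝ (∫ u, h (r, u) ∂μU)) ?_)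
    rw [integral_sub' hpos hneg, integral_fun_fst (fun u => h (r, u)),
      integral_fun_snd h, hmean]
    simp
  simp_rw [hℓ]
  rw [integral_neg, integral_prod _ hloss]
  simp_rw [hcond]
  rw [hφ0, integral_inner_sub_integral_self hφ]
end

section
/- If additionally the representation is linear, contrastive learning with ℓ(t) = −t is linear PCA on the conditionally averaged inputs: defining x̄(r) = ∫_{Ω_U} g(r,u) dμ_U(u) and x̄₀ = ∫_{Ω_R} x̄(r) dμ_R(r), one has ∫ ℓ(⟪h(r,u), h(r,u') − h(r'',u'')⟫) d(μ_R ⊗ μ_U ⊗ μ_U ⊗ μ_R ⊗ μ_U)(r,u,u',r'',u'') = − ∫_{Ω_R} ‖W(x̄(r)) − W(x̄₀)‖² dμ_R(r). -/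
open MeasureTheory ProbabilityTheory
open scoped RealInnerProductSpace

/-- The expected contrastive gap with the identity loss is the variance of the conditional mean. -/
theorem integral_inner_sub_eq_integral_norm_sub_sq
    {ΩR ΩU E : Type*} [MeasurableSpace ΩR] [MeasurableSpace ΩU]
    [NormedAddCommGroup E] [InnerProductSpace ℝ E] [CompleteSpace E]
    [MeasurableSpace E] [BorelSpace E] [SecondCountableTopology E]
    (μR : Measure ΩR) (μU : Measure ΩU)
    [IsProbabilityMeasure μR] [IsProbabilityMeasure μU]
    {h : ΩR × ΩU → E} (hh : Measurable h) {K : ℝ} (hK : ∀ p, ‖h p‖ ≤ K) :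
    (∫ q : ΩR × ΩU × ΩU × ΩR × ΩU,
        ⟪h (q.1, q.2.1), h (q.1, q.2.2.1) - h (q.2.2.2.1, q.2.2.2.2)⟫
        ∂(μR.prod (μU.prod (μU.prod (μR.prod μU)))))
      = ∫ r, ‖(∫ u, h (r, u) ∂μU) - ∫ r', ∫ u, h (r', u) ∂μU ∂μR‖ ^ 2 ∂μR := by
  have hh_int : Integrable h (μR.prod μU) :=
    .of_bound hh.aestronglyMeasurable K (.of_forall hK)
  have h_slice (r : ΩR) : Integrable (fun u => h (r, u)) μU :=
    .of_bound (hh.comp measurable_prodMk_left).aestronglyMeasurable K (.of_forall fun u => hK (r, u))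
  set m : ΩR → E := fun r => ∫ u, h (r, u) ∂μU with hm
  set m₀ : E := ∫ r, m r ∂μR with hm₀
  have h_mean : ∫ p : ΩR × ΩU, h p ∂μR.prod μU = m₀ := integral_prod h hh_int
  have h_bound (a b c : ΩR × ΩU) : ‖⟪h a, h b - h c⟫‖ ≤ K * (K + K) :=
    (norm_inner_le_norm _ _).trans <| mul_le_mul (hK a)
      ((norm_sub_le _ _).trans (add_le_add (hK b) (hK c))) (norm_nonneg _)
      ((norm_nonneg _).trans (hK a))
  have h_inner (r : ΩR) (u u' : ΩU) :
      ∫ p : ΩR × ΩU, ⟪h (r, u), h (r, u') - h (p.1, p.2)⟫ ∂μR.prod μU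
        = ⟪h (r, u), h (r, u') - m₀⟫ := by
    have h_diff : Integrable (fun p => h (r, u') - h p) (μR.prod μU) :=
      (integrable_const _).sub hh_int
    rw [integral_inner h_diff, integral_sub (integrable_const _) hh_int, h_mean]
    simp
  have h_pos (r : ΩR) (u : ΩU) :
      ∫ u', ⟪h (r, u), h (r, u') - m₀⟫ ∂μU = ⟪h (r, u), m r - m₀⟫ := by
    have h_diff : Integrable (fun u' => h (r, u') - m₀) μU :=
      (h_slice r).sub (integrable_const _)
    rw [integral_inner h_diff, integral_sub (h_slice r) (integrable_const _)]
    simp [hm]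
  have h_anchor (r : ΩR) : ∫ u, ⟪h (r, u), m r - m₀⟫ ∂μU = ⟪m r, m r - m₀⟫ := by
    simp_rw [real_inner_comm (m r - m₀)]
    rw [integral_inner (h_slice r)]
  have hm_int : Integrable m μR := hh_int.integral_prod_left
  have hm_bound (r : ΩR) : ‖m r‖ ≤ K := by
    simpa using norm_integral_le_of_norm_le_const (μ := μU) (.of_forall fun u => hK (r, u))
  have h_fubini : (∫ q : ΩR × ΩU × ΩU × ΩR × ΩU,
        ⟪h (q.1, q.2.1), h (q.1, q.2.2.1) - h (q.2.2.2.1, q.2.2.2.2)⟫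
        ∂(μR.prod (μU.prod (μU.prod (μR.prod μU))))) = ∫ r, ⟪m r, m r - m₀⟫ ∂μR := by
    rw [integral_prod _ (.of_bound (Measurable.aestronglyMeasurable (by fun_prop)) _
      (.of_forall fun _ => h_bound _ _ _))]
    congr 1 with r
    rw [integral_prod _ (.of_bound (Measurable.aestronglyMeasurable (by fun_prop)) _
      (.of_forall fun _ => h_bound _ _ _)), ← h_anchor r]
    congr 1 with u
    rw [integral_prod _ (.of_bound (Measurable.aestronglyMeasurable (by fun_prop)) _
      (.of_forall fun _ => h_bound _ _ _)), ← h_pos r u]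
    congr 1 with u'
    exact h_inner r u u'
  have hd_int : Integrable (fun r => m r - m₀) μR := hm_int.sub (integrable_const _)
  have h_sq (r : ΩR) : ‖m r - m₀‖ ^ 2 = ⟪m r, m r - m₀⟫ - ⟪m₀, m r - m₀⟫ := by
    rw [← inner_sub_left, real_inner_self_eq_norm_sq]
  have h_prod_int : Integrable (fun r => ⟪m r, m r - m₀⟫) μR :=
    .of_bound (hm_int.aestronglyMeasurable.inner hd_int.aestronglyMeasurable) (K * (K + ‖m₀‖))
      (.of_forall fun r => (norm_inner_le_norm _ _).trans <| mul_le_mul (hm_bound r)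
        ((norm_sub_le _ _).trans (by grw [hm_bound r])) (norm_nonneg _)
        ((norm_nonneg _).trans (hm_bound r)))
  have h_zero : ∫ r, ⟪m₀, m r - m₀⟫ ∂μR = 0 := by
    rw [integral_inner hd_int, integral_sub hm_int (integrable_const _)]
    simp [hm₀]
  change _ = ∫ r, ‖m r - m₀‖ ^ 2 ∂μR
  simp_rw [h_sq]
  rw [h_fubini, integral_sub h_prod_int (hd_int.const_inner m₀), h_zero, sub_zero]

/-- For a linear representation `h = W ∘ g`, contrastive learning with `ℓ(t) = -t` is linear PCA
on the conditionally averaged inputs. -/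
theorem stmt_1
    {ΩR ΩU : Type*} [MeasurableSpace ΩR] [MeasurableSpace ΩU]
    (μR : Measure ΩR) (μU : Measure ΩU)
    [IsProbabilityMeasure μR] [IsProbabilityMeasure μU]
    {k d : ℕ} (hk : 1 ≤ k) (hd : 1 ≤ d)
    (g : ΩR × ΩU → EuclideanSpace ℝ (Fin d))
    (hgmeas : Measurable g)
    (C : ℝ) (hbdd : ∀ p, ‖g p‖ ≤ C)
    (W : EuclideanSpace ℝ (Fin d) →ₗ[ℝ] EuclideanSpace ℝ (Fin k))
    (h : ΩR × ΩU → EuclideanSpace ℝ (Fin k))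
    (hWg : ∀ p, h p = W (g p))
    (ℓ : ℝ → ℝ) (hℓ : ∀ t, ℓ t = -t)
    (xbar : ΩR → EuclideanSpace ℝ (Fin d))
    (hxbar : ∀ r, xbar r = ∫ u, g (r, u) ∂μU)
    (xbar0 : EuclideanSpace ℝ (Fin d))
    (hxbar0 : xbar0 = ∫ r, xbar r ∂μR) :
    (∫ q : ΩR × ΩU × ΩU × ΩR × ΩU,
        ℓ ⟪h (q.1, q.2.1), h (q.1, q.2.2.1) - h (q.2.2.2.1, q.2.2.2.2)⟫
        ∂(μR.prod (μU.prod (μU.prod (μR.prod μU)))))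
      = - ∫ r, ‖W (xbar r) - W xbar0‖ ^ 2 ∂μR := by
  have hg_int : Integrable g (μR.prod μU) :=
    .of_bound hgmeas.aestronglyMeasurable C (.of_forall hbdd)
  have hg_slice (r : ΩR) : Integrable (fun u => g (r, u)) μU :=
    .of_bound (hgmeas.comp measurable_prodMk_left).aestronglyMeasurable C (.of_forall fun u => hbdd (r, u))
  let L := LinearMap.toContinuousLinearMap W
  have hL (x) : W x = L x := rfl
  have hhL : h = fun p => L (g p) := funext hWg
  have hWxbar (r : ΩR) : W (xbar r) = ∫ u, h (r, u) ∂μU := by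
    rw [hxbar, hL, hhL, L.integral_comp_comm (hg_slice r)]
  have hxbar_int : Integrable xbar μR := by
    rw [funext hxbar]
    exact hg_int.integral_prod_left
  have hWxbar0 : W xbar0 = ∫ r, ∫ u, h (r, u) ∂μU ∂μR := by
    simp_rw [← hWxbar, hxbar0, hL]
    exact (L.integral_comp_comm hxbar_int).symm
  have hh_meas : Measurable h := hhL ▸ L.measurable.comp hgmeas
  have hh_bdd (p) : ‖h p‖ ≤ ‖L‖ * C := by
    rw [hhL]
    exact L.le_opNorm_of_le (hbdd p)
  simp_rw [hℓ, integral_neg, hWxbar, hWxbar0]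
  rw [integral_inner_sub_eq_integral_norm_sub_sq μR μU hh_meas hh_bdd]
end

section
/- For any convex loss ℓ : ℝ → ℝ, the contrastive loss is lower bounded by the corresponding objective of the conditional-mean representation: with φ̄(r) = ∫_{Ω_U} h(r,u) dμ_U(u), one has ∫ ℓ(⟪h(r,u), h(r,u') − h(r'',u'')⟫) d(μ_R ⊗ μ_U ⊗ μ_U ⊗ μ_R ⊗ μ_U)(r,u,u',r'',u'') ≥ ∫∫ ℓ(⟪φ̄(r), φ̄(r) − φ̄(r'')⟫) dμ_R(r) dμ_R(r''). (This is the key step showing the optimal representation does not encode the spurious features: equality holds when h(r,u) is μ_U-almost surely independent of u.) -/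
open MeasureTheory ProbabilityTheory
open scoped RealInnerProductSpace

theorem measurePreserving_prod_left_comm {A B C : Type*} [MeasurableSpace A] [MeasurableSpace B]
    [MeasurableSpace C] (a : Measure A) (b : Measure B) (c : Measure C)
    [SFinite a] [SFinite b] [SFinite c] :
    MeasurePreserving (fun x : A × B × C => (x.2.1, x.1, x.2.2))
      (a.prod (b.prod c)) (b.prod (a.prod c)) :=
  (measurePreserving_prodAssoc b a c).comp
    ((Measure.measurePreserving_swap.prod (MeasurePreserving.id c)).comp
      ((measurePreserving_prodAssoc a b c).symm MeasurableEquiv.prodAssoc))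

theorem measurePreserving_contrastive_reorder {R U : Type*} [MeasurableSpace R]
    [MeasurableSpace U] (μ : Measure R) (ν : Measure U) [SFinite μ] [SFinite ν] :
    MeasurePreserving
      (fun x : (R × R) × U × U × U => (x.1.1, x.2.1, x.2.2.1, x.1.2, x.2.2.2))
      ((μ.prod μ).prod (ν.prod (ν.prod ν))) (μ.prod (ν.prod (ν.prod (μ.prod ν)))) :=
  ((MeasurePreserving.id μ).prod
    (((MeasurePreserving.id ν).prod (measurePreserving_prod_left_comm μ ν ν)).comp
      (measurePreserving_prod_left_comm μ ν (ν.prod ν)))).comp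
    (measurePreserving_prodAssoc μ μ (ν.prod (ν.prod ν)))

theorem integrable_continuous_comp_of_bounded {X : Type*} [MeasurableSpace X] (μ : Measure X)
    [IsFiniteMeasure μ] {f : ℝ → ℝ} (hf : Continuous f) {g : X → ℝ} (hg : Measurable g) {B : ℝ}
    (hB : ∀ x, |g x| ≤ B) : Integrable (fun x => f (g x)) μ := by
  obtain ⟨M, hM⟩ := (isCompact_Icc (a := -B) (b := B)).exists_bound_of_continuousOn
    hf.continuousOn
  exact .of_bound (hf.measurable.comp hg).aestronglyMeasurable M
    (.of_forall fun x => hM _ (abs_le.mp (hB x)))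

theorem abs_inner_sub_le {E : Type*} [NormedAddCommGroup E] [InnerProductSpace ℝ E] {C : ℝ}
    {a b c : E} (ha : ‖a‖ ≤ C) (hb : ‖b‖ ≤ C) (hc : ‖c‖ ≤ C) :
    |⟪a, b - c⟫| ≤ C * (C + C) :=
  (abs_real_inner_le_norm _ _).trans <| mul_le_mul ha
    ((norm_sub_le _ _).trans (add_le_add hb hc)) (norm_nonneg _) ((norm_nonneg _).trans ha)

theorem integral_inner_sub_prod {E U : Type*} [NormedAddCommGroup E] [InnerProductSpace ℝ E]
    [CompleteSpace E] [MeasurableSpace U] (ν : Measure U) [IsProbabilityMeasure ν]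
    {f g : U → E} (hf : Integrable f ν) (hg : Integrable g ν)
    (hint : Integrable (fun w : U × U × U => ⟪f w.1, f w.2.1 - g w.2.2⟫)
      (ν.prod (ν.prod ν))) :
    ∫ w : U × U × U, ⟪f w.1, f w.2.1 - g w.2.2⟫ ∂(ν.prod (ν.prod ν))
      = ⟪∫ u, f u ∂ν, (∫ u, f u ∂ν) - ∫ u, g u ∂ν⟫ := by
  have hf' : Integrable (fun w : U × U => f w.1) (ν.prod ν) := hf.comp_fst ν
  have hg' : Integrable (fun w : U × U => g w.2) (ν.prod ν) := hg.comp_snd ν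
  have hd : ∫ w : U × U, (f w.1 - g w.2) ∂(ν.prod ν) = (∫ u, f u ∂ν) - ∫ u, g u ∂ν := by
    rw [integral_sub hf' hg', integral_fun_fst, integral_fun_snd]
    simp
  rw [integral_prod _ hint]
  simp_rw [integral_inner (hf'.sub' hg'), hd, real_inner_comm _ (f _)]
  rw [integral_inner hf, real_inner_comm]

/-- For any convex loss, the contrastive loss is lower bounded by the corresponding objective of
the conditional-mean representation. -/
theorem stmt_2
    {ΩR ΩU : Type*} [MeasurableSpace ΩR] [MeasurableSpace ΩU]
    (μR : Measure ΩR) (μU : Measure ΩU)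
    [IsProbabilityMeasure μR] [IsProbabilityMeasure μU]
    {k : ℕ} (hk : 1 ≤ k)
    (h : ΩR × ΩU → EuclideanSpace ℝ (Fin k))
    (hmeas : Measurable h)
    (C : ℝ) (hbdd : ∀ p, ‖h p‖ ≤ C)
    (ℓ : ℝ → ℝ) (hconv : ConvexOn ℝ Set.univ ℓ)
    (φbar : ΩR → EuclideanSpace ℝ (Fin k))
    (hφbar : ∀ r, φbar r = ∫ u, h (r, u) ∂μU) :
    (∫ q : ΩR × ΩU × ΩU × ΩR × ΩU,
        ℓ ⟪h (q.1, q.2.1), h (q.1, q.2.2.1) - h (q.2.2.2.1, q.2.2.2.2)⟫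
        ∂(μR.prod (μU.prod (μU.prod (μR.prod μU)))))
      ≥ ∫ r, ∫ r'', ℓ ⟪φbar r, φbar r - φbar r''⟫ ∂μR ∂μR := by
  have hℓ : Continuous ℓ :=
    continuousOn_univ.mp (hconv.continuousOn isOpen_univ)
  have hφm : Measurable φbar := by
    rw [funext hφbar]
    exact (hmeas.stronglyMeasurable.integral_prod_right' (ν := μU)).measurable
  have hφb : ∀ r, ‖φbar r‖ ≤ C := fun r => by
    rw [hφbar]
    simpa using norm_integral_le_of_norm_le_const (μ := μU)
      (.of_forall fun u => hbdd (r, u))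
  have hr : ∀ r, Integrable (fun u => h (r, u)) μU := fun r =>
    .of_bound (hmeas.comp measurable_prodMk_left).aestronglyMeasurable C
      (.of_forall fun u => hbdd (r, u))
  have hG : Integrable (fun x : (ΩR × ΩR) × ΩU × ΩU × ΩU =>
      ℓ ⟪h (x.1.1, x.2.1), h (x.1.1, x.2.2.1) - h (x.1.2, x.2.2.2)⟫)
      ((μR.prod μR).prod (μU.prod (μU.prod μU))) :=
    integrable_continuous_comp_of_bounded _ hℓ (by fun_prop)
      fun x => abs_inner_sub_le (hbdd _) (hbdd _) (hbdd _)
  have hφint : Integrable (fun p : ΩR × ΩR => ℓ ⟪φbar p.1, φbar p.1 - φbar p.2⟫)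
      (μR.prod μR) :=
    integrable_continuous_comp_of_bounded _ hℓ (by fun_prop)
      fun p => abs_inner_sub_le (hφb _) (hφb _) (hφb _)
  have hσ := measurePreserving_contrastive_reorder μR μU
  have hm : Measurable fun q : ΩR × ΩU × ΩU × ΩR × ΩU =>
      ℓ ⟪h (q.1, q.2.1), h (q.1, q.2.2.1) - h (q.2.2.2.1, q.2.2.2.2)⟫ :=
    hℓ.measurable.comp (by fun_prop)
  rw [← hσ.map_eq, integral_map hσ.measurable.aemeasurable
    hm.aestronglyMeasurable, integral_prod _ hG, ← integral_prod _ hφint]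
  refine integral_mono hφint hG.integral_prod_left fun p => ?_
  have hg : Measurable fun w : ΩU × ΩU × ΩU =>
      ⟪h (p.1, w.1), h (p.1, w.2.1) - h (p.2, w.2.2)⟫ := by fun_prop
  have hgB (w : ΩU × ΩU × ΩU) :
      |⟪h (p.1, w.1), h (p.1, w.2.1) - h (p.2, w.2.2)⟫| ≤ C * (C + C) :=
    abs_inner_sub_le (hbdd _) (hbdd _) (hbdd _)
  have hgi := integrable_continuous_comp_of_bounded (μU.prod (μU.prod μU)) continuous_id hg hgB
  have hJ := hconv.map_integral_le hℓ.continuousOn isClosed_univ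
    (.of_forall fun _ => Set.mem_univ _) hgi
    (integrable_continuous_comp_of_bounded _ hℓ hg hgB)
  simp only [id_eq] at hJ hgi
  rw [integral_inner_sub_prod μU (hr p.1) (hr p.2) hgi, ← hφbar, ← hφbar] at hJ
  exact hJ
end

section
/- For a convex function ℓ : ℝ → ℝ, i.i.d. real random variables X and Y, a real random variable W independent of (X, Y), and any a, b ∈ ℝ, one has E[ℓ(W + aX + bY)] ≥ E[ℓ(W + ((a+b)/2)·(X + Y))]; that is, averaging the coefficients of two exchangeable coordinates can only decrease the expected convex loss. -/
open MeasureTheory ProbabilityTheory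

/-- Exchanging the two coordinates of law `μ` preserves the joint law `μ ⊗ μ ⊗ ν`. -/
theorem measurePreserving_swap_fst_snd {α β : Type*} [MeasurableSpace α] [MeasurableSpace β]
    (μ : Measure α) (ν : Measure β) [SFinite μ] [SFinite ν] :
    MeasurePreserving
      (MeasurableEquiv.prodAssoc.symm.trans
        ((MeasurableEquiv.prodComm.prodCongr (MeasurableEquiv.refl β)).trans
          MeasurableEquiv.prodAssoc) : α × α × β ≃ᵐ α × α × β)
      (μ.prod (μ.prod ν)) (μ.prod (μ.prod ν)) :=
  (measurePreserving_prodAssoc μ μ ν).comp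
    ((Measure.measurePreserving_swap.prod (MeasurePreserving.id ν)).comp
      ((measurePreserving_prodAssoc μ μ ν).symm _))

/-- A convex function at a midpoint is at most the average of its values. -/
theorem ConvexOn.map_midpoint_le_half {f : ℝ → ℝ} (hf : ConvexOn ℝ Set.univ f) (x y : ℝ) :
    f ((x + y) / 2) ≤ (f x + f y) / 2 := by
  have h := hf.2 (Set.mem_univ x) (Set.mem_univ y) (show (0 : ℝ) ≤ 1 / 2 by norm_num)
    (show (0 : ℝ) ≤ 1 / 2 by norm_num) (by norm_num)
  simp only [smul_eq_mul] at h
  rw [show (x + y) / 2 = 1 / 2 * x + 1 / 2 * y by ring]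
  linarith

/-- Two-coordinate averaging for a convex loss: with `X, Y` i.i.d. with law `μ` and `W`
independent of `(X, Y)` with law `ν` (joint law `μ ⊗ μ ⊗ ν`),
`E[ℓ(W + aX + bY)] ≥ E[ℓ(W + ((a+b)/2)(X+Y))]`. -/
theorem stmt_3
    (ℓ : ℝ → ℝ) (hconv : ConvexOn ℝ Set.univ ℓ)
    (μ ν : Measure ℝ) [IsProbabilityMeasure μ] [IsProbabilityMeasure ν]
    (a b : ℝ)
    (h1 : Integrable (fun p : ℝ × ℝ × ℝ => ℓ (p.2.2 + a * p.1 + b * p.2.1))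
      (μ.prod (μ.prod ν)))
    (h2 : Integrable (fun p : ℝ × ℝ × ℝ => ℓ (p.2.2 + (a + b) / 2 * (p.1 + p.2.1)))
      (μ.prod (μ.prod ν))) :
    ∫ p : ℝ × ℝ × ℝ, ℓ (p.2.2 + a * p.1 + b * p.2.1) ∂(μ.prod (μ.prod ν))
      ≥ ∫ p : ℝ × ℝ × ℝ, ℓ (p.2.2 + (a + b) / 2 * (p.1 + p.2.1)) ∂(μ.prod (μ.prod ν)) := by
  have hswap := measurePreserving_swap_fst_snd μ ν
  have h3 : Integrable (fun p : ℝ × ℝ × ℝ => ℓ (p.2.2 + a * p.2.1 + b * p.1))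
      (μ.prod (μ.prod ν)) :=
    hswap.integrable_comp_of_integrable h1
  have heq : ∫ p : ℝ × ℝ × ℝ, ℓ (p.2.2 + a * p.2.1 + b * p.1) ∂(μ.prod (μ.prod ν))
      = ∫ p : ℝ × ℝ × ℝ, ℓ (p.2.2 + a * p.1 + b * p.2.1) ∂(μ.prod (μ.prod ν)) :=
    hswap.integral_comp' (fun p : ℝ × ℝ × ℝ => ℓ (p.2.2 + a * p.1 + b * p.2.1))
  calc ∫ p : ℝ × ℝ × ℝ, ℓ (p.2.2 + (a + b) / 2 * (p.1 + p.2.1)) ∂(μ.prod (μ.prod ν))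
      ≤ ∫ p : ℝ × ℝ × ℝ, (ℓ (p.2.2 + a * p.1 + b * p.2.1)
          + ℓ (p.2.2 + a * p.2.1 + b * p.1)) / 2 ∂(μ.prod (μ.prod ν)) := by
        refine integral_mono h2 ((h1.add h3).div_const 2) fun p => ?_
        have hmid : p.2.2 + (a + b) / 2 * (p.1 + p.2.1)
            = ((p.2.2 + a * p.1 + b * p.2.1) + (p.2.2 + a * p.2.1 + b * p.1)) / 2 := by ring
        dsimp only
        rw [hmid]
        exact hconv.map_midpoint_le_half _ _
    _ = ∫ p : ℝ × ℝ × ℝ, ℓ (p.2.2 + a * p.1 + b * p.2.1) ∂(μ.prod (μ.prod ν)) := by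
        rw [integral_div, integral_add h1 h3, heq]
        ring
end

section
/- The minimum of the block-structured contrastive objective is attained at block-uniform weights: the infimum of g over the feasible set {a : |a_j| ≤ 1 for all j ∈ J, Σ_{j∈J} a_j² ≤ r} equals the minimum over (α, α_1, …, α_T) ∈ [0,1]^{T+1} with s·α + (r−s)·Σ_{t=1}^T α_t ≤ r of Σ_{t=1}^T w_t · E[ℓ(α·σ_{S,t}²·Z + α_t·σ_{R,t}²·Z_t)], i.e. the minimum of g is achieved at a configuration with a_j² = α for all j ∈ S and a_j² = α_t for all j ∈ P_t. -/
open MeasureTheory ProbabilityTheory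

/-- The block-structured contrastive objective `g`, over coefficients indexed by the disjoint
union of the shared block `S ≃ Fin s` and the private blocks `P_t ≃ Fin (r-s)`. -/
noncomputable def gObj (s r T : ℕ) (ℓ : ℝ → ℝ) (w σS σR : Fin T → ℝ)
    (a : (Fin s ⊕ Fin T × Fin (r - s)) → ℝ) : ℝ :=
  ∑ t, w t * ∫ ζ : (Fin s ⊕ Fin T × Fin (r - s)) → ℝ,
      ℓ (σS t ^ 2 * ∑ j : Fin s, a (Sum.inl j) ^ 2 * ζ (Sum.inl j) ^ 2
        + σR t ^ 2 * ∑ j : Fin (r - s), a (Sum.inr (t, j)) ^ 2 * ζ (Sum.inr (t, j)) ^ 2)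
    ∂(Measure.pi fun _ => gaussianReal 0 1)

/-- The block-uniform objective `ψ(α, α_1, …, α_T) = Σ_t w_t E[ℓ(α σ_{S,t}² Z + α_t σ_{R,t}² Z_t)]`
where `Z ~ χ²_s` and `Z_t ~ χ²_{r-s}`. -/
noncomputable def psiObj (s r T : ℕ) (ℓ : ℝ → ℝ) (w σS σR : Fin T → ℝ)
    (α : ℝ) (αt : Fin T → ℝ) : ℝ :=
  ∑ t, w t * ∫ ζ : (Fin s ⊕ Fin T × Fin (r - s)) → ℝ,
      ℓ (α * σS t ^ 2 * ∑ j : Fin s, ζ (Sum.inl j) ^ 2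
        + αt t * σR t ^ 2 * ∑ j : Fin (r - s), ζ (Sum.inr (t, j)) ^ 2)
    ∂(Measure.pi fun _ => gaussianReal 0 1)

/-- The expectation of `ℓ` at the weighted sum of squares `∑ j, c j * b j * ζ j ^ 2` of i.i.d.
standard normal variables `ζ`. -/
noncomputable def gaussianSqExpect {ι : Type*} [Fintype ι] (ℓ : ℝ → ℝ) (c b : ι → ℝ) : ℝ :=
  ∫ ζ : ι → ℝ, ℓ (∑ j, c j * b j * ζ j ^ 2) ∂(Measure.pi fun _ => gaussianReal 0 1)

section GaussianSqExpect

variable {ι : Type*} [Fintype ι] {ℓ : ℝ → ℝ} {c b : ι → ℝ}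

theorem sum_mul_sq_nonneg (hc : 0 ≤ c) (hb : 0 ≤ b) (ζ : ι → ℝ) :
    0 ≤ ∑ j, c j * b j * ζ j ^ 2 :=
  Finset.sum_nonneg fun j _ => mul_nonneg (mul_nonneg (hc j) (hb j)) (sq_nonneg _)

theorem exists_norm_le_of_antitone_of_bddBelow (hanti : Antitone ℓ)
    (hbdd : BddBelow (Set.range ℓ)) : ∃ C, ∀ x, 0 ≤ x → ‖ℓ x‖ ≤ C := by
  obtain ⟨m, hm⟩ := hbdd
  refine ⟨max |m| |ℓ 0|, fun x hx => ?_⟩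
  exact abs_le_max_abs_abs (hm ⟨x, rfl⟩) (hanti hx)

theorem integrable_comp_sum_mul_sq (hℓ : Continuous ℓ) (hanti : Antitone ℓ)
    (hbdd : BddBelow (Set.range ℓ)) (hc : 0 ≤ c) (hb : 0 ≤ b) :
    Integrable (fun ζ : ι → ℝ => ℓ (∑ j, c j * b j * ζ j ^ 2))
      (Measure.pi fun _ => gaussianReal 0 1) := by
  obtain ⟨C, hC⟩ := exists_norm_le_of_antitone_of_bddBelow hanti hbdd
  exact Integrable.of_bound (Continuous.aestronglyMeasurable (by fun_prop)) C
    (ae_of_all _ fun ζ => hC _ (sum_mul_sq_nonneg hc hb ζ))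

theorem continuousOn_gaussianSqExpect (hℓ : Continuous ℓ) (hanti : Antitone ℓ)
    (hbdd : BddBelow (Set.range ℓ)) (hc : 0 ≤ c) :
    ContinuousOn (gaussianSqExpect ℓ c) (Set.Ici 0) := by
  obtain ⟨C, hC⟩ := exists_norm_le_of_antitone_of_bddBelow hanti hbdd
  refine continuousOn_of_dominated (bound := fun _ => C)
    (fun b _ => Continuous.aestronglyMeasurable (by fun_prop))
    (fun b hb => ae_of_all _ fun ζ => hC _ (sum_mul_sq_nonneg hc hb ζ))
    (integrable_const C) (ae_of_all _ fun ζ => ?_)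
  exact Continuous.continuousOn (by fun_prop)

theorem convexOn_gaussianSqExpect (hconv : ConvexOn ℝ Set.univ ℓ) (hanti : Antitone ℓ)
    (hbdd : BddBelow (Set.range ℓ)) (hc : 0 ≤ c) :
    ConvexOn ℝ (Set.Ici 0) (gaussianSqExpect ℓ c) := by
  have hℓ : Continuous ℓ := continuousOn_univ.mp (hconv.continuousOn isOpen_univ)
  refine ⟨convex_Ici 0, fun b hb b' hb' x y hx hy hxy => ?_⟩
  have hi := integrable_comp_sum_mul_sq hℓ hanti hbdd hc hb
  have hi' := integrable_comp_sum_mul_sq hℓ hanti hbdd hc hb'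
  simp only [gaussianSqExpect, smul_eq_mul]
  rw [← integral_const_mul, ← integral_const_mul,
    ← integral_add (hi.const_mul x) (hi'.const_mul y)]
  refine integral_mono (integrable_comp_sum_mul_sq hℓ hanti hbdd hc
    (convex_Ici 0 hb hb' hx hy hxy)) ((hi.const_mul x).add (hi'.const_mul y)) fun ζ => ?_
  have h := hconv.2 (Set.mem_univ (∑ j, c j * b j * ζ j ^ 2))
    (Set.mem_univ (∑ j, c j * b' j * ζ j ^ 2)) hx hy hxy
  simp only [smul_eq_mul] at h
  convert h using 2
  simp only [Finset.mul_sum, ← Finset.sum_add_distrib]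
  refine Finset.sum_congr rfl fun j _ => ?_
  simp only [Pi.add_apply, Pi.smul_apply, smul_eq_mul]
  ring

theorem gaussianSqExpect_comp_equiv (ℓ : ℝ → ℝ) (b : ι → ℝ) (e : ι ≃ ι) (hce : ∀ j, c (e j) = c j) :
    gaussianSqExpect ℓ c (b ∘ e) = gaussianSqExpect ℓ c b := by
  have h := (measurePreserving_piCongrLeft (fun _ : ι => gaussianReal 0 1) e).integral_comp'
    fun ζ : ι → ℝ => ℓ (∑ j, c j * b j * ζ j ^ 2)
  rw [gaussianSqExpect, gaussianSqExpect, ← h]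
  refine integral_congr_ae (ae_of_all _ fun ζ => ?_)
  refine congrArg ℓ (Eq.trans ?_ (Equiv.sum_comp e _))
  simp [MeasurableEquiv.coe_piCongrLeft, hce, Equiv.piCongrLeft_apply_apply (fun _ : ι => ℝ) e]

end GaussianSqExpect

section Blocks

variable {s m T : ℕ}

/-- The coefficients of task `t`: `x` on the shared block, `y` on the `t`-th private block and
`0` on the other private blocks. -/
def taskCoeff (s m : ℕ) (t : Fin T) (x y : ℝ) : Fin s ⊕ Fin T × Fin m → ℝ :=
  Sum.elim (fun _ => x) fun p => if p.1 = t then y else 0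

theorem taskCoeff_nonneg (t : Fin T) {x y : ℝ} (hx : 0 ≤ x) (hy : 0 ≤ y) :
    0 ≤ taskCoeff s m t x y := by
  rintro (j | p)
  · exact hx
  · simp only [taskCoeff, Sum.elim_inr, Pi.zero_apply]
    split_ifs <;> simp [hy]

theorem sum_taskCoeff_mul (t : Fin T) (x y : ℝ) (b : Fin s ⊕ Fin T × Fin m → ℝ)
    (ζ : Fin s ⊕ Fin T × Fin m → ℝ) :
    ∑ j, taskCoeff s m t x y j * b j * ζ j ^ 2
      = x * ∑ j, b (Sum.inl j) * ζ (Sum.inl j) ^ 2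
        + y * ∑ j, b (Sum.inr (t, j)) * ζ (Sum.inr (t, j)) ^ 2 := by
  simp only [Fintype.sum_sum_type, Fintype.sum_prod_type, taskCoeff, Sum.elim_inl, Sum.elim_inr,
    Finset.mul_sum, mul_assoc]
  congr 1
  rw [Finset.sum_eq_single t]
  · simp
  · intro t' _ ht'
    simp [ht']
  · simp

/-- The objective as a function of the squared weights. -/
noncomputable def sqObj (s m T : ℕ) (ℓ : ℝ → ℝ) (w σS σR : Fin T → ℝ)
    (b : Fin s ⊕ Fin T × Fin m → ℝ) : ℝ :=
  ∑ t, w t * gaussianSqExpect ℓ (taskCoeff s m t (σS t ^ 2) (σR t ^ 2)) b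

/-- The vector equal to `α` on the shared block and to `β t` on the `t`-th private block. -/
def blockUniform (s m : ℕ) (α : ℝ) (β : Fin T → ℝ) : Fin s ⊕ Fin T × Fin m → ℝ :=
  Sum.elim (fun _ => α) fun p => β p.1

theorem gObj_eq_sqObj (s r T : ℕ) (ℓ : ℝ → ℝ) (w σS σR : Fin T → ℝ)
    (a : Fin s ⊕ Fin T × Fin (r - s) → ℝ) :
    gObj s r T ℓ w σS σR a = sqObj s (r - s) T ℓ w σS σR fun j => a j ^ 2 := by
  simp only [gObj, sqObj, gaussianSqExpect, sum_taskCoeff_mul]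

theorem psiObj_eq_sqObj (s r T : ℕ) (ℓ : ℝ → ℝ) (w σS σR : Fin T → ℝ) (α : ℝ) (β : Fin T → ℝ) :
    psiObj s r T ℓ w σS σR α β
      = sqObj s (r - s) T ℓ w σS σR (blockUniform s (r - s) α β) := by
  simp only [psiObj, sqObj, gaussianSqExpect, sum_taskCoeff_mul, blockUniform, Sum.elim_inl,
    Sum.elim_inr, ← Finset.mul_sum]
  simp only [← mul_assoc, mul_comm]

theorem continuousOn_sqObj {ℓ : ℝ → ℝ} (hℓ : Continuous ℓ) (hanti : Antitone ℓ)
    (hbdd : BddBelow (Set.range ℓ)) (w σS σR : Fin T → ℝ) :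
    ContinuousOn (sqObj s m T ℓ w σS σR) (Set.Ici 0) :=
  continuousOn_finsetSum _ fun t _ => continuousOn_const.mul
    (continuousOn_gaussianSqExpect hℓ hanti hbdd
      (taskCoeff_nonneg t (sq_nonneg _) (sq_nonneg _)))

theorem convexOn_sqObj {ℓ : ℝ → ℝ} (hconv : ConvexOn ℝ Set.univ ℓ) (hanti : Antitone ℓ)
    (hbdd : BddBelow (Set.range ℓ)) {w : Fin T → ℝ} (hw : ∀ t, 0 ≤ w t) (σS σR : Fin T → ℝ) :
    ConvexOn ℝ (Set.Ici 0) (sqObj s m T ℓ w σS σR) := by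
  have h : ConvexOn ℝ (Set.Ici 0) (∑ t, fun b : Fin s ⊕ Fin T × Fin m → ℝ =>
      w t • gaussianSqExpect ℓ (taskCoeff s m t (σS t ^ 2) (σR t ^ 2)) b) :=
    Finset.sum_induction _ (ConvexOn ℝ (Set.Ici 0)) (fun _ _ => ConvexOn.add)
      (convexOn_const 0 (convex_Ici 0)) fun t _ =>
        (convexOn_gaussianSqExpect hconv hanti hbdd
          (taskCoeff_nonneg t (sq_nonneg _) (sq_nonneg _))).smul (hw t)
  convert h using 1
  ext b
  simp [sqObj]

/-- The permutation shifting the shared block by `g.1` and every private block by `g.2`. -/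
def blockShift [NeZero s] [NeZero m] (g : Fin s × Fin m) :
    Fin s ⊕ Fin T × Fin m ≃ Fin s ⊕ Fin T × Fin m :=
  Equiv.sumCongr (Equiv.addLeft g.1) (Equiv.prodCongr (Equiv.refl _) (Equiv.addLeft g.2))

theorem sqObj_comp_blockShift [NeZero s] [NeZero m] (ℓ : ℝ → ℝ) (w σS σR : Fin T → ℝ)
    (b : Fin s ⊕ Fin T × Fin m → ℝ) (g : Fin s × Fin m) :
    sqObj s m T ℓ w σS σR (b ∘ blockShift g) = sqObj s m T ℓ w σS σR b := by
  refine Finset.sum_congr rfl fun t _ => ?_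
  rw [gaussianSqExpect_comp_equiv]
  rintro (j | p) <;> simp [blockShift, taskCoeff]

/-- Replacing the entries of `b` by their mean over each block. -/
noncomputable def blockMean (b : Fin s ⊕ Fin T × Fin m → ℝ) : Fin s ⊕ Fin T × Fin m → ℝ :=
  blockUniform s m ((∑ j, b (Sum.inl j)) / s) fun t => (∑ j, b (Sum.inr (t, j))) / m

theorem blockMean_eq_sum_blockShift [NeZero s] [NeZero m] (b : Fin s ⊕ Fin T × Fin m → ℝ) :
    blockMean b = ∑ g : Fin s × Fin m, ((s : ℝ) * m)⁻¹ • (b ∘ blockShift g) := by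
  have hs : (s : ℝ) ≠ 0 := NeZero.ne _
  have hm : (m : ℝ) ≠ 0 := NeZero.ne _
  ext (j | ⟨t, j⟩)
  · have h := Equiv.sum_comp (Equiv.addRight j) fun k => b (Sum.inl k)
    simp only [Equiv.coe_addRight] at h
    simp only [blockMean, blockUniform, blockShift, Finset.sum_apply, Fintype.sum_prod_type,
      Pi.smul_apply, Function.comp_apply, Equiv.sumCongr_apply, Sum.map_inl, Sum.elim_inl,
      Equiv.coe_addLeft, smul_eq_mul, Finset.sum_const, Finset.card_univ, Fintype.card_fin,
      nsmul_eq_mul, ← Finset.mul_sum, h]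
    field_simp
  · have h := Equiv.sum_comp (Equiv.addRight j) fun k => b (Sum.inr (t, k))
    simp only [Equiv.coe_addRight] at h
    simp only [blockMean, blockUniform, blockShift, Finset.sum_apply, Fintype.sum_prod_type,
      Pi.smul_apply, Function.comp_apply, Equiv.sumCongr_apply, Sum.map_inr, Sum.elim_inr,
      Equiv.prodCongr_apply, Prod.map_apply, Equiv.refl_apply,
      Equiv.coe_addLeft, smul_eq_mul, Finset.sum_const, Finset.card_univ, Fintype.card_fin,
      nsmul_eq_mul, ← Finset.mul_sum, h]
    field_simp

theorem sqObj_blockMean_le [NeZero s] [NeZero m] {ℓ : ℝ → ℝ} (hconv : ConvexOn ℝ Set.univ ℓ)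
    (hanti : Antitone ℓ) (hbdd : BddBelow (Set.range ℓ)) {w : Fin T → ℝ} (hw : ∀ t, 0 ≤ w t)
    (σS σR : Fin T → ℝ) {b : Fin s ⊕ Fin T × Fin m → ℝ} (hb : 0 ≤ b) :
    sqObj s m T ℓ w σS σR (blockMean b) ≤ sqObj s m T ℓ w σS σR b := by
  have hs : (s : ℝ) ≠ 0 := NeZero.ne _
  have hm : (m : ℝ) ≠ 0 := NeZero.ne _
  have h1 : ∑ _g : Fin s × Fin m, ((s : ℝ) * m)⁻¹ = 1 := by
    simp
    field_simp
  rw [blockMean_eq_sum_blockShift]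
  refine ((convexOn_sqObj hconv hanti hbdd hw σS σR).map_sum_le
    (p := fun g => b ∘ blockShift g) (fun _ _ => by positivity) h1
    fun g _ j => hb (blockShift g j)).trans_eq ?_
  simp only [sqObj_comp_blockShift, ← Finset.sum_smul, h1, one_smul]

theorem sum_blockUniform (α : ℝ) (β : Fin T → ℝ) :
    ∑ j, blockUniform s m α β j = s * α + m * ∑ t, β t := by
  simp [blockUniform, Fintype.sum_sum_type, Fintype.sum_prod_type, Finset.mul_sum]

theorem sum_blockMean [NeZero s] [NeZero m] (b : Fin s ⊕ Fin T × Fin m → ℝ) :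
    ∑ j, blockMean b j = ∑ j, b j := by
  have hs : (s : ℝ) ≠ 0 := NeZero.ne _
  have hm : (m : ℝ) ≠ 0 := NeZero.ne _
  rw [blockMean, sum_blockUniform, ← Finset.sum_div, mul_div_cancel₀ _ hs, mul_div_cancel₀ _ hm,
    Fintype.sum_sum_type, Fintype.sum_prod_type]

theorem sum_div_card_mem_Icc {n : ℕ} {f : Fin n → ℝ} (h0 : ∀ j, 0 ≤ f j) (h1 : ∀ j, f j ≤ 1) :
    0 ≤ (∑ j, f j) / n ∧ (∑ j, f j) / n ≤ 1 := by
  refine ⟨div_nonneg (Finset.sum_nonneg fun j _ => h0 j) n.cast_nonneg,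
    div_le_one_of_le₀ ?_ n.cast_nonneg⟩
  simpa using Finset.sum_le_sum fun j (_ : j ∈ Finset.univ) => h1 j

theorem exists_blockUniform_isMinOn_sqObj [NeZero s] [NeZero m] {ℓ : ℝ → ℝ}
    (hconv : ConvexOn ℝ Set.univ ℓ) (hanti : Antitone ℓ) (hbdd : BddBelow (Set.range ℓ))
    {w : Fin T → ℝ} (hw : ∀ t, 0 ≤ w t) (σS σR : Fin T → ℝ) {R : ℝ} (hR : 0 ≤ R) :
    ∃ (α : ℝ) (β : Fin T → ℝ), (0 ≤ α ∧ α ≤ 1) ∧ (∀ t, 0 ≤ β t ∧ β t ≤ 1) ∧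
      s * α + m * ∑ t, β t ≤ R ∧
      ∀ b : Fin s ⊕ Fin T × Fin m → ℝ, 0 ≤ b → b ≤ 1 → ∑ j, b j ≤ R →
        sqObj s m T ℓ w σS σR (blockUniform s m α β) ≤ sqObj s m T ℓ w σS σR b := by
  have hℓ : Continuous ℓ := continuousOn_univ.mp (hconv.continuousOn isOpen_univ)
  have hK : IsCompact (Set.Icc (0 : Fin s ⊕ Fin T × Fin m → ℝ) 1 ∩ {b | ∑ j, b j ≤ R}) :=
    isCompact_Icc.inter_right (isClosed_le (by fun_prop) continuous_const)
  obtain ⟨b, ⟨⟨hb0, hb1⟩, hbR⟩, hmin⟩ := hK.exists_isMinOn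
    ⟨0, ⟨le_rfl, zero_le_one⟩, by simpa using hR⟩
    ((continuousOn_sqObj hℓ hanti hbdd w σS σR).mono fun b hb => hb.1.1)
  refine ⟨_, _, sum_div_card_mem_Icc (fun j => hb0 (Sum.inl j)) fun j => hb1 (Sum.inl j),
    fun t => sum_div_card_mem_Icc (fun j => hb0 (Sum.inr (t, j))) fun j => hb1 (Sum.inr (t, j)),
    ?_, fun b' h0 h1 hR' => (sqObj_blockMean_le hconv hanti hbdd hw σS σR hb0).trans
      (hmin ⟨⟨h0, h1⟩, hR'⟩)⟩
  rw [← sum_blockUniform]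
  exact (sum_blockMean b).trans_le hbR

end Blocks

/-- The minimum of the block-structured contrastive objective over the feasible set
`{a : |a_j| ≤ 1, Σ_j a_j² ≤ r}` is attained at block-uniform weights `a_j² = α` on `S`,
`a_j² = α_t` on `P_t`, and equals the constrained minimum of `ψ`. -/
theorem stmt_6 {s r T : ℕ} (hs : 1 ≤ s) (hsr : s < r) (hT : 1 ≤ T)
    (ℓ : ℝ → ℝ) (hconv : ConvexOn ℝ Set.univ ℓ) (hanti : Antitone ℓ)
    (hbdd : BddBelow (Set.range ℓ))
    (σS σR : Fin T → ℝ) (hσS : ∀ t, 0 < σS t) (hσR : ∀ t, 0 < σR t)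
    (w : Fin T → ℝ) (hw : ∀ t, 0 < w t) (hwsum : ∑ t, w t = 1) :
    ∃ (α : ℝ) (αt : Fin T → ℝ),
      (0 ≤ α ∧ α ≤ 1) ∧ (∀ t, 0 ≤ αt t ∧ αt t ≤ 1) ∧
      (s : ℝ) * α + ((r : ℝ) - s) * ∑ t, αt t ≤ r ∧
      -- the block-uniform configuration is feasible and realizes the value ψ(α, α_1, …, α_T)
      (∀ j, |Sum.elim (fun _ : Fin s => Real.sqrt α)
          (fun p : Fin T × Fin (r - s) => Real.sqrt (αt p.1)) j| ≤ 1) ∧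
      (∑ j, Sum.elim (fun _ : Fin s => Real.sqrt α)
          (fun p : Fin T × Fin (r - s) => Real.sqrt (αt p.1)) j ^ 2 ≤ r) ∧
      gObj s r T ℓ w σS σR (Sum.elim (fun _ : Fin s => Real.sqrt α)
          (fun p : Fin T × Fin (r - s) => Real.sqrt (αt p.1)))
        = psiObj s r T ℓ w σS σR α αt ∧
      -- it minimizes g over the feasible set
      (∀ a : (Fin s ⊕ Fin T × Fin (r - s)) → ℝ,
        (∀ j, |a j| ≤ 1) → (∑ j, a j ^ 2 ≤ r) →
        psiObj s r T ℓ w σS σR α αt ≤ gObj s r T ℓ w σS σR a) ∧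
      -- and (α, α_1, …, α_T) minimizes ψ over its constraint set
      (∀ (α' : ℝ) (αt' : Fin T → ℝ),
        (0 ≤ α' ∧ α' ≤ 1) → (∀ t, 0 ≤ αt' t ∧ αt' t ≤ 1) →
        (s : ℝ) * α' + ((r : ℝ) - s) * ∑ t, αt' t ≤ r →
        psiObj s r T ℓ w σS σR α αt ≤ psiObj s r T ℓ w σS σR α' αt') := by
  have : NeZero s := ⟨by omega⟩
  have : NeZero (r - s) := ⟨by omega⟩
  have hcast : ((r - s : ℕ) : ℝ) = (r : ℝ) - s := Nat.cast_sub hsr.le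
  obtain ⟨α, β, hα, hβ, hR, hmin⟩ := exists_blockUniform_isMinOn_sqObj (s := s) (m := r - s)
    hconv hanti hbdd (fun t => (hw t).le) σS σR r.cast_nonneg
  have hsq : (fun j => Sum.elim (fun _ : Fin s => Real.sqrt α)
      (fun p : Fin T × Fin (r - s) => Real.sqrt (β p.1)) j ^ 2)
        = blockUniform s (r - s) α β := by
    ext (j | p)
    · exact Real.sq_sqrt hα.1
    · exact Real.sq_sqrt (hβ p.1).1
  refine ⟨α, β, hα, hβ, hcast ▸ hR, ?_, ?_, ?_, fun a ha hsum => ?_, fun α' β' hα' hβ' hR' => ?_⟩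
  · rintro (j | p)
    · simpa [abs_of_nonneg] using hα.2
    · simpa [abs_of_nonneg] using (hβ p.1).2
  · rw [hsq, sum_blockUniform]
    exact hR
  · rw [gObj_eq_sqObj, psiObj_eq_sqObj, hsq]
  · rw [gObj_eq_sqObj, psiObj_eq_sqObj]
    exact hmin _ (fun j => sq_nonneg _) (fun j => (sq_le_one_iff_abs_le_one _).2 (ha j)) hsum
  · rw [psiObj_eq_sqObj, psiObj_eq_sqObj]
    refine hmin _ ?_ ?_ ?_
    · rintro (j | p)
      exacts [hα'.1, (hβ' p.1).1]
    · rintro (j | p)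
      exacts [hα'.2, (hβ' p.1).2]
    · rw [sum_blockUniform, hcast]
      exact hR'
end

section
/- Generalization bound for linear probing on a weighted-feature representation: there is an absolute constant C > 0 (independent of all parameters) such that with probability at least 1 − δ over the m samples, the empirical risk minimizer û satisfies E_{(z,y)}[ℓ_c(⟪û, ψ(z)⟫, y)] ≤ 4L·√((1/m)·(v₁/α + v₂/β))·(√(s·α·σ_S² + (r−s)·β·σ_R²) + C·√(max{α·σ_S², β·σ_R²}²·r / (s·α·σ_S² + (r−s)·β·σ_R²))) + 8·√(2·ln(4/δ)/m). -/
open MeasureTheory ProbabilityTheory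

/-- Law of a sample `z ∈ ℝ^r`: independent coordinates `N(0,σS²)` for `j < s` and `N(0,σR²)`
for `s ≤ j < r`. -/
noncomputable def sampleMeasure (r s : ℕ) (σS σR : ℝ) : Measure (Fin r → ℝ) :=
  Measure.pi fun j =>
    gaussianReal 0 (if (j : ℕ) < s then Real.toNNReal (σS ^ 2) else Real.toNNReal (σR ^ 2))

/-- The representation's feature map `ψ(z) = Q·(√α z_1, …, √α z_s, √β z_{s+1}, …, √β z_r, 0, …, 0)`. -/
noncomputable def featMap (k r s : ℕ) (Q : Matrix (Fin k) (Fin k) ℝ) (α β : ℝ)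
    (z : Fin r → ℝ) : Fin k → ℝ :=
  Q.mulVec fun i =>
    if h : (i : ℕ) < r then (if (i : ℕ) < s then Real.sqrt α else Real.sqrt β) * z ⟨i, h⟩ else 0

theorem sum_signs_fin_succ {M : Type*} [AddCommMonoid M] {n : ℕ} (F : (Fin (n + 1) → ℤˣ) → M) :
    ∑ ε, F ε = ∑ ε : Fin n → ℤˣ, (F (Fin.cons 1 ε) + F (Fin.cons (-1) ε)) := by
  rw [← (Fin.consEquiv fun _ => ℤˣ).sum_comp, Fintype.sum_prod_type, Finset.sum_comm]
  refine Finset.sum_congr rfl fun ε _ => ?_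
  simp [Fin.consEquiv, UnitsInt.univ]

theorem iSup_add_iSup_sub_le_of_abs_sub_le {ι : Type*} [Finite ι] [Nonempty ι] (b a a' : ι → ℝ)
    (h : ∀ i j, |a i - a j| ≤ |a' i - a' j|) :
    (⨆ i, (b i + a i)) + ⨆ i, (b i - a i) ≤ (⨆ i, (b i + a' i)) + ⨆ i, (b i - a' i) := by
  have hp : ∀ i, b i + a' i ≤ ⨆ i, (b i + a' i) := le_ciSup (Set.finite_range _).bddAbove
  have hm : ∀ i, b i - a' i ≤ ⨆ i, (b i - a' i) := le_ciSup (Set.finite_range _).bddAbove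
  refine ciSup_add_ciSup_le fun i j => ?_
  have h1 := (le_abs_self _).trans (h i j)
  rcases abs_cases (a' i - a' j) with ⟨h2, -⟩ | ⟨h2, -⟩
  · linarith [hp i, hm j]
  · linarith [hp j, hm i]

/-- The **Ledoux–Talagrand contraction principle** for finite classes. -/
theorem sum_signs_iSup_le_of_abs_sub_le {ι : Type*} [Finite ι] [Nonempty ι] {n : ℕ}
    (b : ι → ℝ) (A A' : ι → Fin n → ℝ) (h : ∀ i j k, |A i k - A j k| ≤ |A' i k - A' j k|) :
    ∑ ε : Fin n → ℤˣ, ⨆ i, (b i + ∑ k, ((ε k : ℤ) : ℝ) * A i k)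
      ≤ ∑ ε : Fin n → ℤˣ, ⨆ i, (b i + ∑ k, ((ε k : ℤ) : ℝ) * A' i k) := by
  induction n generalizing b with
  | zero => simp
  | succ n ih =>
    have step : ∀ (x : ℝ), ∑ ε : Fin n → ℤˣ, ⨆ i, (b i + (x * A' i 0
          + ∑ k : Fin n, ((ε k : ℤ) : ℝ) * A i k.succ))
        ≤ ∑ ε : Fin n → ℤˣ, ⨆ i, (b i + (x * A' i 0
          + ∑ k : Fin n, ((ε k : ℤ) : ℝ) * A' i k.succ)) := by
      intro x
      simp only [← add_assoc]
      exact ih _ (fun i k => A i k.succ) (fun i k => A' i k.succ) fun i j k => h i j k.succ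
    simp only [sum_signs_fin_succ, Fin.sum_univ_succ, Fin.cons_zero, Fin.cons_succ,
      Finset.sum_add_distrib]
    refine le_trans ?_ (add_le_add (step _) (step _))
    rw [← Finset.sum_add_distrib, ← Finset.sum_add_distrib]
    refine Finset.sum_le_sum fun ε _ => ?_
    convert iSup_add_iSup_sub_le_of_abs_sub_le
      (fun i => b i + ∑ k : Fin n, ((ε k : ℤ) : ℝ) * A i k.succ) (fun i => A i 0)
      (fun i => A' i 0) (fun i j => h i j 0) using 3 <;> ext i <;> push_cast <;> ring_nf

theorem sum_signs_norm_sq {H : Type*} [NormedAddCommGroup H] [InnerProductSpace ℝ H] {n : ℕ}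
    (v : H) (x : Fin n → H) :
    ∑ ε : Fin n → ℤˣ, ‖v + ∑ k, ((ε k : ℤ) : ℝ) • x k‖ ^ 2
      = 2 ^ n * (‖v‖ ^ 2 + ∑ k, ‖x k‖ ^ 2) := by
  induction n generalizing v with
  | zero => simp
  | succ n ih =>
    simp only [sum_signs_fin_succ, Fin.sum_univ_succ, Fin.cons_zero, Fin.cons_succ,
      Finset.sum_add_distrib, ← add_assoc, ih]
    have := parallelogram_law_with_norm ℝ v (x 0)
    push_cast
    simp only [one_smul, neg_smul, ← sub_eq_add_neg]
    rw [pow_succ]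
    linear_combination 2 ^ n * this

theorem sum_signs_norm_le {H : Type*} [NormedAddCommGroup H] [InnerProductSpace ℝ H] {n : ℕ}
    (x : Fin n → H) :
    ∑ ε : Fin n → ℤˣ, ‖∑ k, ((ε k : ℤ) : ℝ) • x k‖ ≤ 2 ^ n * √(∑ k, ‖x k‖ ^ 2) := by
  have h1 := sq_sum_le_card_mul_sum_sq (s := (Finset.univ : Finset (Fin n → ℤˣ)))
    (f := fun ε => ‖∑ k, ((ε k : ℤ) : ℝ) • x k‖)
  have h2 := sum_signs_norm_sq 0 x
  simp only [zero_add] at h2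
  have hcard : ((Finset.univ : Finset (Fin n → ℤˣ)).card : ℝ) = 2 ^ n := by simp
  rw [h2, hcard] at h1
  refine abs_le_of_sq_le_sq' ?_ (by positivity) |>.2
  rw [mul_pow, Real.sq_sqrt (by positivity)]
  simp at h1
  linarith

theorem measurable_sum_eval_iSup {X ι : Type*} [MeasurableSpace X] [Finite ι]
    {n : ℕ} {g : ι → X → ℝ} (hg : ∀ i, Measurable (g i)) (a : Fin n → ℝ) :
    Measurable fun ω : Fin n → X => ⨆ i, ∑ k, a k * g i (ω k) := by
  refine Measurable.iSup fun i => Finset.measurable_sum _ fun k _ => ?_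
  exact ((hg i).comp (measurable_pi_apply k)).const_mul _

theorem abs_iSup_le {ι : Type*} [Nonempty ι] {f : ι → ℝ} {M : ℝ} (h : ∀ i, |f i| ≤ M) :
    |⨆ i, f i| ≤ M := by
  have hb : BddAbove (Set.range f) := ⟨M, by rintro _ ⟨i, rfl⟩; exact (abs_le.mp (h i)).2⟩
  obtain ⟨i⟩ := ‹Nonempty ι›
  exact abs_le.mpr ⟨(abs_le.mp (h i)).1.trans (le_ciSup hb i),
    @ciSup_le _ _ _ ⟨i⟩ _ _ fun i => (abs_le.mp (h i)).2⟩

/-- **Symmetrization** for finite classes of functions with values in `[0, 1]`. -/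
theorem integral_iSup_le_sum_signs {X ι : Type*} [MeasurableSpace X] (μ : Measure X)
    [IsProbabilityMeasure μ] [Finite ι] [Nonempty ι] {n : ℕ} {g : ι → X → ℝ}
    (hg : ∀ i, Measurable (g i)) (h01 : ∀ i x, g i x ∈ Set.Icc (0 : ℝ) 1) :
    2 ^ n * ∫ ω, ⨆ i, ∑ k : Fin n, ((∫ x, g i x ∂μ) - g i (ω k)) ∂(Measure.pi fun _ => μ)
      ≤ 2 * ∫ ω, ∑ ε : Fin n → ℤˣ, ⨆ i, ∑ k, ((ε k : ℤ) : ℝ) * g i (ω k)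
          ∂(Measure.pi fun _ => μ) := by
  have hgi : ∀ i, Integrable (g i) μ := fun i =>
    Integrable.of_mem_Icc 0 1 (hg i).aemeasurable (ae_of_all _ (h01 i))
  have habs : ∀ i x y, |g i x - g i y| ≤ 1 := fun i x y => by
    have h1 := h01 i x
    have h2 := h01 i y
    rw [abs_le]
    constructor <;> linarith [h1.1, h1.2, h2.1, h2.2]
  have hsgn : ∀ u : ℤˣ, |((u : ℤ) : ℝ)| = 1 := fun u => by
    rcases Int.units_eq_one_or u with rfl | rfl <;> simp
  set S : (Fin n → ℤˣ) → (Fin n → X) → ℝ :=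
    fun ε ω => ⨆ i, ∑ k, ((ε k : ℤ) : ℝ) * g i (ω k) with hS
  have hSm : ∀ ε, Measurable (S ε) := fun ε => measurable_sum_eval_iSup hg _
  have hSi : ∀ ε, Integrable (S ε) (Measure.pi fun _ => μ) := fun ε => by
    refine Integrable.of_bound (hSm ε).aestronglyMeasurable n (ae_of_all _ fun ω => ?_)
    refine abs_iSup_le fun i => (Finset.abs_sum_le_sum_abs _ _).trans ?_
    refine (Finset.sum_le_card_nsmul _ _ 1 fun k _ => ?_).trans (by simp)
    rw [abs_mul, hsgn, one_mul, abs_of_nonneg (h01 i _).1]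
    exact (h01 i _).2
  set D : (Fin n → ℤˣ) → (Fin n → X × X) → ℝ :=
    fun ε ω => ⨆ i, ∑ k, ((ε k : ℤ) : ℝ) * (g i (ω k).1 - g i (ω k).2) with hD
  have hDm : ∀ ε, Measurable (D ε) := fun ε =>
    measurable_sum_eval_iSup (g := fun i (p : X × X) => g i p.1 - g i p.2)
      (fun i => ((hg i).comp measurable_fst).sub ((hg i).comp measurable_snd)) _
  have hDb : ∀ ε ω, |D ε ω| ≤ n := fun ε ω => by
    refine abs_iSup_le fun i => (Finset.abs_sum_le_sum_abs _ _).trans ?_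
    refine (Finset.sum_le_card_nsmul _ _ 1 fun k _ => ?_).trans (by simp)
    rw [abs_mul, hsgn, one_mul]
    exact habs i _ _
  have hDi : ∀ ε, Integrable (D ε) (Measure.pi fun _ => μ.prod μ) := fun ε =>
    Integrable.of_bound (hDm ε).aestronglyMeasurable n (ae_of_all _ (hDb ε))
  have hghost : ∫ ω, ⨆ i, ∑ k : Fin n, ((∫ x, g i x ∂μ) - g i (ω k)) ∂(Measure.pi fun _ => μ)
      ≤ ∫ p, D 1 p ∂(Measure.pi fun _ => μ.prod μ) := by
    have hp := (measurePreserving_arrowProdEquivProdArrow X X (Fin n) (fun _ => μ) fun _ => μ).symm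
    have hi := (hp.integrable_comp_emb (MeasurableEquiv.measurableEmbedding _)).mpr (hDi 1)
    rw [← hp.integral_comp (MeasurableEquiv.measurableEmbedding _)]
    have hfub := integral_prod_symm _ hi
    refine le_trans (integral_mono ?_ hi.integral_prod_right fun ω => ?_) hfub.ge
    · refine Integrable.of_bound (Measurable.aestronglyMeasurable ?_) n (ae_of_all _ fun ω => ?_)
      · simpa using measurable_sum_eval_iSup (g := fun i x => (∫ x, g i x ∂μ) - g i x)
          (fun i => (hg i).const_sub _) (1 : Fin n → ℝ)
      · refine abs_iSup_le fun i => (Finset.abs_sum_le_sum_abs _ _).trans ?_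
        refine (Finset.sum_le_card_nsmul _ _ 1 fun k _ => ?_).trans (by simp)
        have h1 := h01 i (ω k)
        have h2 : (∫ x, g i x ∂μ) ∈ Set.Icc (0 : ℝ) 1 :=
          (convex_Icc 0 1).integral_mem isClosed_Icc (ae_of_all _ (h01 i)) (hgi i)
        rw [abs_le]
        constructor <;> linarith [h1.1, h1.2, h2.1, h2.2]
    · refine ciSup_le fun i => ?_
      have hev : ∀ k, Integrable (fun x : Fin n → X => g i (x k)) (Measure.pi fun _ => μ) :=
        fun k => integrable_comp_eval (hgi i)
      have heq : ∑ k : Fin n, ((∫ x, g i x ∂μ) - g i (ω k))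
          = ∫ x, ∑ k : Fin n, (g i (x k) - g i (ω k)) ∂(Measure.pi fun _ => μ) := by
        rw [integral_finsetSum Finset.univ (f := fun k (x : Fin n → X) => g i (x k) - g i (ω k))
          fun k _ => (hev k).sub (integrable_const _)]
        refine Finset.sum_congr rfl fun k _ => ?_
        rw [integral_sub (hev k) (integrable_const _),
          integral_comp_eval (μ := fun _ : Fin n => μ) (i := k) (hg i).aestronglyMeasurable]
        simp
      rw [heq]
      refine integral_mono (integrable_finsetSum _ fun k _ => (hev k).sub (integrable_const _)) ?_
        fun x => ?_
      · refine Integrable.of_bound (Measurable.aestronglyMeasurable ?_) n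
          (ae_of_all _ fun x => hDb 1 _)
        exact ((hDm 1).comp (MeasurableEquiv.measurable _)).comp measurable_prodMk_right
      · refine le_of_eq_of_le ?_ (le_ciSup (Set.finite_range _).bddAbove i)
        simp [MeasurableEquiv.arrowProdEquivProdArrow, Equiv.arrowProdEquivProdArrow]
  have hswap : ∀ ε, ∫ p, D 1 p ∂(Measure.pi fun _ => μ.prod μ)
      = ∫ p, D ε p ∂(Measure.pi fun _ => μ.prod μ) := by
    intro ε
    have hT : MeasurePreserving (fun (p : Fin n → X × X) k => if ε k = 1 then p k else (p k).swap)
        (Measure.pi fun _ => μ.prod μ) (Measure.pi fun _ => μ.prod μ) := by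
      refine measurePreserving_pi (f := fun k (q : X × X) => if ε k = 1 then q else q.swap) _ _
        fun k => ?_
      by_cases h : ε k = 1
      · simpa [h] using! MeasurePreserving.id (μ.prod μ)
      · simpa [h] using Measure.measurePreserving_swap
    conv_lhs => rw [← hT.map_eq]
    rw [integral_map hT.aemeasurable (hDm 1).aestronglyMeasurable]
    refine integral_congr_ae (ae_of_all _ fun p => iSup_congr fun i => ?_)
    refine Finset.sum_congr rfl fun k _ => ?_
    rcases Int.units_eq_one_or (ε k) with h | h <;> simp [h]
  have hsplit : ∀ ε, ∫ p, D ε p ∂(Measure.pi fun _ => μ.prod μ)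
      ≤ (∫ ω, S ε ω ∂(Measure.pi fun _ => μ)) + ∫ ω, S (-ε) ω ∂(Measure.pi fun _ => μ) := by
    intro ε
    have h1 : MeasurePreserving (fun (p : Fin n → X × X) k => (p k).1)
        (Measure.pi fun _ => μ.prod μ) (Measure.pi fun _ => μ) :=
      measurePreserving_pi _ _ fun _ => measurePreserving_fst
    have h2 : MeasurePreserving (fun (p : Fin n → X × X) k => (p k).2)
        (Measure.pi fun _ => μ.prod μ) (Measure.pi fun _ => μ) :=
      measurePreserving_pi _ _ fun _ => measurePreserving_snd
    have hi1 : Integrable (fun p : Fin n → X × X => S ε fun k => (p k).1)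
        (Measure.pi fun _ => μ.prod μ) := h1.integrable_comp_of_integrable (hSi ε)
    have hi2 : Integrable (fun p : Fin n → X × X => S (-ε) fun k => (p k).2)
        (Measure.pi fun _ => μ.prod μ) := h2.integrable_comp_of_integrable (hSi (-ε))
    have hmap : ∀ {T : (Fin n → X × X) → Fin n → X},
        MeasurePreserving T (Measure.pi fun _ => μ.prod μ) (Measure.pi fun _ => μ) → ∀ ε,
        ∫ ω, S ε ω ∂(Measure.pi fun _ => μ) = ∫ p, S ε (T p) ∂(Measure.pi fun _ => μ.prod μ) := by
      intro T hT ε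
      rw [← hT.map_eq, integral_map hT.aemeasurable (hSm ε).aestronglyMeasurable]
    rw [hmap h1 ε, hmap h2 (-ε), ← integral_add hi1 hi2]
    refine integral_mono (hDi ε) (hi1.add hi2) fun p => ciSup_le fun i => ?_
    refine le_of_eq_of_le ?_ (add_le_add (le_ciSup (Set.finite_range _).bddAbove i)
      (le_ciSup (Set.finite_range _).bddAbove i))
    rw [← Finset.sum_add_distrib]
    refine Finset.sum_congr rfl fun k _ => ?_
    simp
    ring
  calc _ ≤ 2 ^ n * ∫ p, D 1 p ∂(Measure.pi fun _ => μ.prod μ) := by gcongr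
    _ = ∑ ε : Fin n → ℤˣ, ∫ p, D ε p ∂(Measure.pi fun _ => μ.prod μ) := by
      simp [← hswap]
    _ ≤ ∑ ε : Fin n → ℤˣ, ((∫ ω, S ε ω ∂(Measure.pi fun _ => μ))
          + ∫ ω, S (-ε) ω ∂(Measure.pi fun _ => μ)) := Finset.sum_le_sum fun ε _ => hsplit ε
    _ = _ := by
      rw [Finset.sum_add_distrib,
        Fintype.sum_equiv (Equiv.neg (Fin n → ℤˣ)) (fun ε => ∫ ω, S (-ε) ω ∂(Measure.pi fun _ => μ))
          (fun ε => ∫ ω, S ε ω ∂(Measure.pi fun _ => μ)) fun _ => rfl,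
        integral_finsetSum _ fun ε _ => hSi ε, two_mul]

theorem Measurable.finCons {X Y : Type*} [MeasurableSpace X] [MeasurableSpace Y] {n : ℕ}
    {a : Y → X} {y : Y → Fin n → X} (ha : Measurable a) (hy : Measurable y) :
    Measurable fun p => (Fin.cons (a p) (y p) : Fin (n + 1) → X) := by
  refine measurable_pi_iff.mpr fun i => ?_
  induction i using Fin.cases with
  | zero => simpa using ha
  | succ i => simpa using measurable_pi_iff.mp hy i

theorem integral_pi_fin_succ {X E : Type*} [MeasurableSpace X] [NormedAddCommGroup E]
    [NormedSpace ℝ E] (μ : Measure X) [SigmaFinite μ] {n : ℕ} {f : (Fin (n + 1) → X) → E}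
    (hf : Integrable f (Measure.pi fun _ => μ)) :
    ∫ x, f x ∂(Measure.pi fun _ => μ)
      = ∫ a, ∫ y, f (Fin.cons a y) ∂(Measure.pi fun _ => μ) ∂μ := by
  have hp := (measurePreserving_piFinSuccAbove (fun _ : Fin (n + 1) => μ) 0).symm
  have hi := (hp.integrable_comp_emb (MeasurableEquiv.measurableEmbedding _)).mpr hf
  rw [← hp.integral_comp (MeasurableEquiv.measurableEmbedding _) f]
  refine (integral_prod _ hi).trans ?_
  simp [MeasurableEquiv.piFinSuccAbove, Fin.insertNthEquiv]

theorem hasSubgaussianMGF_of_bounded_differences {X : Type*} [MeasurableSpace X] (μ : Measure X)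
    [IsProbabilityMeasure μ] (c : NNReal) {n : ℕ} {f : (Fin n → X) → ℝ} (hf : Measurable f)
    {M : ℝ} (hM : ∀ x, |f x| ≤ M)
    (hc : ∀ x i a, |f (Function.update x i a) - f x| ≤ c) :
    HasSubgaussianMGF (fun x => f x - ∫ y, f y ∂(Measure.pi fun _ => μ)) (n * (c / 2) ^ 2)
      (Measure.pi fun _ => μ) := by
  have hint : ∀ {n : ℕ} {f : (Fin n → X) → ℝ} (hf : Measurable f) (hM : ∀ x, |f x| ≤ M),
      Integrable f (Measure.pi fun _ => μ) := fun hf hM =>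
    Integrable.of_bound hf.aestronglyMeasurable M (ae_of_all _ hM)
  have hexp : ∀ {n : ℕ} {f : (Fin n → X) → ℝ} (hf : Measurable f) (hM : ∀ x, |f x| ≤ M) (t b : ℝ),
      Integrable (fun x => Real.exp (t * (f x - b))) (Measure.pi fun _ => μ) := by
    intro n f hf hM t b
    refine Integrable.of_bound (by fun_prop) (Real.exp (|t| * (M + |b|))) (ae_of_all _ fun x => ?_)
    rw [Real.norm_eq_abs, Real.abs_exp]
    refine Real.exp_le_exp.mpr ?_
    calc t * (f x - b) ≤ |t * (f x - b)| := le_abs_self _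
      _ ≤ _ := by
        rw [abs_mul]
        gcongr
        exact (abs_sub _ _).trans (by gcongr; exact hM x)
  refine ⟨fun t => hexp hf hM t _, fun t => ?_⟩
  induction n with
  | zero =>
    have : ∀ x y : Fin 0 → X, x = y := fun x y => Subsingleton.elim _ _
    have h0 : ∀ x : Fin 0 → X, f x - ∫ y, f y ∂(Measure.pi fun _ => μ) = 0 := by
      intro x
      rw [integral_congr_ae (g := fun _ => f x) (ae_of_all _ fun y => by rw [this y x])]
      simp
    simp [mgf, h0]
  | succ n ih =>
    have hcons : ∀ a, Measurable fun y : Fin n → X => f (Fin.cons a y) := fun a =>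
      hf.comp (measurable_const.finCons measurable_id)
    set g : X → ℝ := fun a => ∫ y, f (Fin.cons a y) ∂(Measure.pi fun _ => μ) with hg
    have hgm : Measurable g := by
      have : Measurable fun p : X × (Fin n → X) => f (Fin.cons p.1 p.2) :=
        hf.comp (measurable_fst.finCons measurable_snd)
      exact this.stronglyMeasurable.integral_prod_right.measurable
    have hmean : ∫ x, f x ∂(Measure.pi fun _ => μ) = ∫ a, g a ∂μ :=
      integral_pi_fin_succ μ (hint hf hM)
    have hgdiff : ∀ a b, g b ≤ g a + c := by
      intro a b
      have : g b ≤ ∫ y, (f (Fin.cons a y) + c) ∂(Measure.pi fun _ => μ) := by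
        refine integral_mono (hint (hcons b) fun y => hM _)
          ((hint (hcons a) fun y => hM _).add (integrable_const _)) fun y => ?_
        have := hc (Fin.cons a y) 0 b
        rw [Fin.update_cons_zero] at this
        linarith [(abs_le.mp this).2]
      rwa [integral_add (hint (hcons a) fun y => hM _) (integrable_const _), integral_const,
        probReal_univ, one_smul] at this
    have hne : Nonempty X := nonempty_of_isProbabilityMeasure μ
    have hbdd : BddBelow (Set.range g) := by
      refine ⟨g hne.some - c, ?_⟩
      rintro _ ⟨a, rfl⟩
      linarith [hgdiff a hne.some]
    have hsub := (hasSubgaussianMGF_of_mem_Icc (μ := μ) (a := ⨅ a, g a) (b := (⨅ a, g a) + c)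
      hgm.aemeasurable (ae_of_all _ fun a => ⟨ciInf_le hbdd a, by
        rw [← sub_le_iff_le_add]
        exact le_ciInf fun b => by linarith [hgdiff b a]⟩))
    have hmgf := hsub.mgf_le t
    simp only [mgf, add_sub_cancel_left] at hmgf
    rw [mgf, hmean, integral_pi_fin_succ μ (hexp hf hM t _)]
    have key : ∀ a, ∫ y, Real.exp (t * (f (Fin.cons a y) - ∫ a, g a ∂μ)) ∂(Measure.pi fun _ => μ)
        ≤ Real.exp ((n * (c / 2) ^ 2 : NNReal) * t ^ 2 / 2)
          * Real.exp (t * (g a - ∫ a, g a ∂μ)) := by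
      intro a
      have h1 := ih (f := fun y => f (Fin.cons a y)) (hcons a) (fun y => hM _) (fun y i b => by
        have := hc (Fin.cons a y) i.succ b
        rwa [← Fin.cons_update] at this)
      rw [mgf] at h1
      rw [← integral_congr_ae (ae_of_all _ fun y => ?_), integral_mul_const]
      · exact mul_le_mul_of_nonneg_right h1 (Real.exp_pos _).le
      · simp only [← Real.exp_add]
        congr 1
        simp only [hg]
        ring
    have hgi : Integrable (fun a => Real.exp (t * (g a - ∫ a, g a ∂μ))) μ :=
      hsub.integrable_exp_mul t
    refine (integral_mono_of_nonneg (ae_of_all _ fun a => integral_nonneg fun y =>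
      (Real.exp_pos _).le) (hgi.const_mul _) (ae_of_all _ key)).trans ?_
    rw [integral_const_mul]
    refine (mul_le_mul_of_nonneg_left hmgf (Real.exp_pos _).le).trans_eq ?_
    rw [← Real.exp_add]
    congr 1
    push_cast
    simp
    ring

/-- Bound on the expected uniform deviation by the **Rademacher complexity** of a Lipschitz loss
composed with linear predictors of norm at most `B`. -/
theorem integral_iSup_deviation_le {X ι H : Type*} [MeasurableSpace X] (μ : Measure X)
    [IsProbabilityMeasure μ] [Finite ι] [Nonempty ι] [NormedAddCommGroup H]
    [InnerProductSpace ℝ H] {n : ℕ} {g : ι → X → ℝ} (hg : ∀ i, Measurable (g i))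
    (h01 : ∀ i x, g i x ∈ Set.Icc (0 : ℝ) 1) {φ : X → H} (hφ : Integrable (fun x => ‖φ x‖ ^ 2) μ)
    {w : ι → H} {B L : ℝ} (hB : ∀ i, ‖w i‖ ≤ B) (hL : 0 ≤ L)
    (hlip : ∀ i j x, |g i x - g j x| ≤ L * |inner ℝ (w i - w j) (φ x)|) :
    ∫ ω, ⨆ i, ∑ k : Fin n, ((∫ x, g i x ∂μ) - g i (ω k)) ∂(Measure.pi fun _ => μ)
      ≤ 2 * (L * B * √(n * ∫ x, ‖φ x‖ ^ 2 ∂μ)) := by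
  have hB0 : 0 ≤ B := (norm_nonneg _).trans (hB (Classical.arbitrary ι))
  have hev : ∀ k, Integrable (fun ω : Fin n → X => ‖φ (ω k)‖ ^ 2) (Measure.pi fun _ => μ) :=
    fun k => integrable_comp_eval (μ := fun _ : Fin n => μ) (f := fun x => ‖φ x‖ ^ 2) hφ
  have hsum : Integrable (fun ω : Fin n → X => ∑ k, ‖φ (ω k)‖ ^ 2) (Measure.pi fun _ => μ) :=
    integrable_finsetSum _ fun k _ => hev k
  have hsq : ∀ ω : Fin n → X, √(∑ k, ‖φ (ω k)‖ ^ 2) ^ 2 = ∑ k, ‖φ (ω k)‖ ^ 2 := fun ω =>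
    Real.sq_sqrt (by positivity)
  have hL2 : MemLp (fun ω : Fin n → X => √(∑ k, ‖φ (ω k)‖ ^ 2)) 2 (Measure.pi fun _ => μ) := by
    rw [memLp_two_iff_integrable_sq
      (Real.continuous_sqrt.comp_aestronglyMeasurable hsum.aestronglyMeasurable)]
    simpa only [hsq] using hsum
  have hsqrt : ∫ ω, √(∑ k : Fin n, ‖φ (ω k)‖ ^ 2) ∂(Measure.pi fun _ => μ)
      ≤ √(n * ∫ x, ‖φ x‖ ^ 2 ∂μ) := by
    refine Real.le_sqrt_of_sq_le ?_
    have hv := variance_nonneg (fun ω : Fin n → X => √(∑ k, ‖φ (ω k)‖ ^ 2)) (Measure.pi fun _ => μ)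
    rw [variance_eq_sub hL2] at hv
    have : (Measure.pi fun _ => μ)[(fun ω : Fin n → X => √(∑ k, ‖φ (ω k)‖ ^ 2)) ^ 2]
        = n * ∫ x, ‖φ x‖ ^ 2 ∂μ := by
      simp only [Pi.pow_apply, hsq]
      rw [integral_finsetSum _ fun k _ => hev k, Finset.sum_congr rfl fun k _ =>
        integral_comp_eval (μ := fun _ : Fin n => μ) (i := k) hφ.aestronglyMeasurable]
      simp
    linarith
  have hpt : ∀ ω : Fin n → X, ∑ ε : Fin n → ℤˣ, ⨆ i, ∑ k, ((ε k : ℤ) : ℝ) * g i (ω k)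
      ≤ 2 ^ n * (L * B) * √(∑ k, ‖φ (ω k)‖ ^ 2) := by
    intro ω
    have hcon := sum_signs_iSup_le_of_abs_sub_le 0 (fun i k => g i (ω k))
      (fun i k => L * inner ℝ (w i) (φ (ω k))) fun i j k => by
        rw [← mul_sub, ← inner_sub_left, abs_mul, abs_of_nonneg hL]
        exact hlip i j (ω k)
    simp only [Pi.zero_apply, zero_add] at hcon
    refine hcon.trans ?_
    calc _ ≤ ∑ ε : Fin n → ℤˣ, L * B * ‖∑ k, ((ε k : ℤ) : ℝ) • φ (ω k)‖ := by
          refine Finset.sum_le_sum fun ε _ => ciSup_le fun i => ?_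
          have : ∑ k, ((ε k : ℤ) : ℝ) * (L * inner ℝ (w i) (φ (ω k)))
              = L * inner ℝ (w i) (∑ k, ((ε k : ℤ) : ℝ) • φ (ω k)) := by
            rw [inner_sum, Finset.mul_sum]
            refine Finset.sum_congr rfl fun k _ => ?_
            rw [real_inner_smul_right]
            ring
          rw [this, mul_assoc]
          gcongr
          exact (real_inner_le_norm _ _).trans (by gcongr; exact hB i)
      _ ≤ L * B * (2 ^ n * √(∑ k, ‖φ (ω k)‖ ^ 2)) := by
          rw [← Finset.mul_sum]
          gcongr
          exact sum_signs_norm_le _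
      _ = _ := by ring
  have hR : ∫ ω, ∑ ε : Fin n → ℤˣ, ⨆ i, ∑ k, ((ε k : ℤ) : ℝ) * g i (ω k) ∂(Measure.pi fun _ => μ)
      ≤ 2 ^ n * (L * B) * √(n * ∫ x, ‖φ x‖ ^ 2 ∂μ) := by
    by_cases hint : Integrable (fun ω : Fin n → X => ∑ ε : Fin n → ℤˣ, ⨆ i,
      ∑ k, ((ε k : ℤ) : ℝ) * g i (ω k)) (Measure.pi fun _ => μ)
    · refine (integral_mono hint ((hL2.integrable one_le_two).const_mul _) hpt).trans ?_
      rw [integral_const_mul]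
      gcongr
    · rw [integral_undef hint]
      positivity
  have hsym := integral_iSup_le_sum_signs μ (n := n) hg h01
  refine le_of_mul_le_mul_left (hsym.trans ?_) (by positivity : (0 : ℝ) < 2 ^ n)
  linarith

theorem measure_exists_deviation_le_of_finite {X ι H : Type*} [MeasurableSpace X] (μ : Measure X)
    [IsProbabilityMeasure μ] [Finite ι] [NormedAddCommGroup H]
    [InnerProductSpace ℝ H] {n : ℕ} (hn : 0 < n) {g : ι → X → ℝ} (hg : ∀ i, Measurable (g i))
    (h01 : ∀ i x, g i x ∈ Set.Icc (0 : ℝ) 1) {φ : X → H} (hφ : Integrable (fun x => ‖φ x‖ ^ 2) μ)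
    {w : ι → H} {B L δ : ℝ} (hB : ∀ i, ‖w i‖ ≤ B) (hL : 0 ≤ L)
    (hlip : ∀ i j x, |g i x - g j x| ≤ L * |inner ℝ (w i - w j) (φ x)|) (hδ : 0 < δ)
    (hδ1 : δ ≤ 1) :
    (Measure.pi fun _ : Fin n => μ) {ω | ∃ i, 2 * (L * B * √(n * ∫ x, ‖φ x‖ ^ 2 ∂μ))
      + √(n * Real.log (1 / δ) / 2) < ∑ k, ((∫ x, g i x ∂μ) - g i (ω k))} ≤ ENNReal.ofReal δ := by
  rcases isEmpty_or_nonempty ι with hι | hι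
  · simp
  have hgi : ∀ i, Integrable (g i) μ := fun i =>
    Integrable.of_mem_Icc 0 1 (hg i).aemeasurable (ae_of_all _ (h01 i))
  set Z : (Fin n → X) → ℝ := fun ω => ⨆ i, ∑ k, ((∫ x, g i x ∂μ) - g i (ω k)) with hZ
  have hle : ∀ ω i, ∑ k, ((∫ x, g i x ∂μ) - g i (ω k)) ≤ Z ω := fun ω i =>
    le_ciSup (f := fun i => ∑ k, ((∫ x, g i x ∂μ) - g i (ω k))) (Set.finite_range _).bddAbove i
  have hZm : Measurable Z := by
    simpa [hZ] using measurable_sum_eval_iSup (g := fun i x => (∫ x, g i x ∂μ) - g i x)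
      (fun i => (hg i).const_sub _) (1 : Fin n → ℝ)
  have hZb : ∀ ω, |Z ω| ≤ n := fun ω => by
    refine abs_iSup_le fun i => (Finset.abs_sum_le_sum_abs _ _).trans ?_
    refine (Finset.sum_le_card_nsmul _ _ 1 fun k _ => ?_).trans (by simp)
    have h1 := h01 i (ω k)
    have h2 : (∫ x, g i x ∂μ) ∈ Set.Icc (0 : ℝ) 1 :=
      (convex_Icc 0 1).integral_mem isClosed_Icc (ae_of_all _ (h01 i)) (hgi i)
    rw [abs_le]
    constructor <;> linarith [h1.1, h1.2, h2.1, h2.2]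
  have hone : ∀ (ω ω' : Fin n → X) (j : Fin n), (∀ k, k ≠ j → ω k = ω' k) → Z ω ≤ Z ω' + 1 := by
    intro ω ω' j h
    refine ciSup_le fun i => ?_
    refine le_trans ?_ (add_le_add_left (hle ω' i) 1)
    rw [← Finset.add_sum_erase _ _ (Finset.mem_univ j),
      ← Finset.add_sum_erase _ (fun k => (∫ x, g i x ∂μ) - g i (ω' k)) (Finset.mem_univ j),
      Finset.sum_congr rfl fun k hk => by rw [h k (Finset.ne_of_mem_erase hk)]]
    linarith [(h01 i (ω j)).1, (h01 i (ω' j)).2]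
  have hsub := hasSubgaussianMGF_of_bounded_differences μ 1 hZm hZb fun ω j a => by
    rw [abs_sub_le_iff, NNReal.coe_one]
    constructor
    · linarith [hone (Function.update ω j a) ω j fun k hk => Function.update_of_ne hk _ _]
    · linarith [hone ω (Function.update ω j a) j fun k hk => (Function.update_of_ne hk _ _).symm]
  have hlog : 0 ≤ Real.log (1 / δ) := Real.log_nonneg (by rw [le_div_iff₀ hδ]; linarith)
  have hmcd := hsub.measure_ge_le (Real.sqrt_nonneg (n * Real.log (1 / δ) / 2))
  have hval : Real.exp (-√(n * Real.log (1 / δ) / 2) ^ 2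
      / (2 * ((n * (1 / 2) ^ 2 : NNReal) : ℝ))) = δ := by
    rw [Real.sq_sqrt (by positivity)]
    push_cast
    have hn' : (n : ℝ) ≠ 0 := by positivity
    rw [show -(n * Real.log (1 / δ) / 2) / (2 * (n * (1 / 2) ^ 2)) = Real.log δ by
      rw [one_div, Real.log_inv]; field_simp, Real.exp_log hδ]
  rw [hval] at hmcd
  refine le_trans (measure_mono ?_)
    ((ENNReal.le_ofReal_iff_toReal_le (measure_ne_top _ _) hδ.le).mpr hmcd)
  rintro ω ⟨i, hi⟩
  have := integral_iSup_deviation_le μ (n := n) hg h01 hφ hB hL hlip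
  simp only [Set.mem_ofPred_eq]
  linarith [hle ω i]

theorem measure_exists_le_of_forall_finset {Ω ι : Type*} [MeasurableSpace Ω] (μ : Measure Ω)
    [Countable ι] {p : ι → Ω → Prop} {c : ENNReal}
    (h : ∀ F : Finset ι, μ {ω | ∃ i ∈ F, p i ω} ≤ c) : μ {ω | ∃ i, p i ω} ≤ c := by
  have hU : {ω | ∃ i, p i ω} = ⋃ F : Finset ι, {ω | ∃ i ∈ F, p i ω} := by
    ext ω
    simp only [Set.mem_ofPred_eq, Set.mem_iUnion]
    exact ⟨fun ⟨i, hi⟩ => ⟨{i}, i, by simp, hi⟩, fun ⟨_, i, _, hi⟩ => ⟨i, hi⟩⟩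
  have hmono : Monotone fun F : Finset ι => {ω | ∃ i ∈ F, p i ω} :=
    fun F G hFG ω ⟨i, hi, hp⟩ => ⟨i, hFG hi, hp⟩
  rw [hU, hmono.directed_le.measure_iUnion]
  exact iSup_le h

/-- Uniform deviation bound for a countable class of `[0, 1]`-valued losses that are Lipschitz in
linear predictors of norm at most `B`. -/
theorem measure_exists_deviation_le {X ι H : Type*} [MeasurableSpace X] (μ : Measure X)
    [IsProbabilityMeasure μ] [Countable ι] [NormedAddCommGroup H]
    [InnerProductSpace ℝ H] {n : ℕ} (hn : 0 < n) {g : ι → X → ℝ}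
    (hg : ∀ i, AEStronglyMeasurable (g i) μ)
    (h01 : ∀ i x, g i x ∈ Set.Icc (0 : ℝ) 1) {φ : X → H} (hφ : Integrable (fun x => ‖φ x‖ ^ 2) μ)
    {w : ι → H} {B L δ : ℝ} (hB : ∀ i, ‖w i‖ ≤ B) (hL : 0 ≤ L)
    (hlip : ∀ i j x, |g i x - g j x| ≤ L * |inner ℝ (w i - w j) (φ x)|) (hδ : 0 < δ)
    (hδ1 : δ ≤ 1) :
    (Measure.pi fun _ : Fin n => μ) {ω | ∃ i, 2 * (L * B * √(n * ∫ x, ‖φ x‖ ^ 2 ∂μ))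
      + √(n * Real.log (1 / δ) / 2) < ∑ k, ((∫ x, g i x ∂μ) - g i (ω k))} ≤ ENNReal.ofReal δ := by
  obtain ⟨N, hsub, hNm, hN0⟩ := exists_measurable_superset_of_null
    (ae_iff.mp (ae_all_iff.mpr fun i => (hg i).ae_eq_mk))
  have hmk : ∀ x ∉ N, ∀ i, g i x = (hg i).mk _ x := fun x hx => by
    by_contra h
    exact hx (hsub h)
  set g' : ι → X → ℝ := fun i => Nᶜ.indicator (g i) with hg'
  have hg'm : ∀ i, Measurable (g' i) := fun i => by
    have : g' i = Nᶜ.indicator ((hg i).mk _) := by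
      ext x
      by_cases hx : x ∈ N
      · simp [hg', hx]
      · simp [hg', hx, hmk x hx i]
    rw [this]
    exact (hg i).stronglyMeasurable_mk.measurable.indicator hNm.compl
  have hae : ∀ᵐ x ∂μ, x ∉ N := measure_eq_zero_iff_ae_notMem.mp hN0
  have hint : ∀ i, ∫ x, g' i x ∂μ = ∫ x, g i x ∂μ := fun i => by
    refine integral_congr_ae ?_
    filter_upwards [hae] with x hx
    simp [hg', hx]
  have hpi : ∀ᵐ ω ∂(Measure.pi fun _ : Fin n => μ), ∀ k, ω k ∉ N := ae_all_iff.mpr fun k =>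
    (measurePreserving_eval (fun _ : Fin n => μ) k).quasiMeasurePreserving.ae hae
  have hfin := measure_exists_le_of_forall_finset (Measure.pi fun _ : Fin n => μ)
    (p := fun i ω => 2 * (L * B * √(n * ∫ x, ‖φ x‖ ^ 2 ∂μ))
      + √(n * Real.log (1 / δ) / 2) < ∑ k, ((∫ x, g' i x ∂μ) - g' i (ω k)))
    (c := ENNReal.ofReal δ) fun F => by
      have := measure_exists_deviation_le_of_finite μ hn (ι := F) (g := fun i => g' i)
        (w := fun i => w i) (fun i => hg'm i) (fun i x => ?_) hφ (fun i => hB i) hL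
        (fun i j x => ?_) hδ hδ1
      · simpa using this
      · by_cases hx : x ∈ N
        · simp [hg', hx]
        · simpa [hg', hx] using h01 i x
      · by_cases hx : x ∈ N
        · simp only [hg', Set.indicator, Set.mem_compl_iff, hx, not_true_eq_false, if_false,
            sub_self, abs_zero]
          positivity
        · simpa [hg', hx] using hlip i j x
  refine (measure_mono_ae ?_).trans hfin
  filter_upwards [hpi] with ω hω
  rintro ⟨i, hi⟩
  refine ⟨i, ?_⟩
  rw [hint]
  simpa [hg', hω] using hi

theorem measure_exists_deviation_le_of_separableSpace {X ι H : Type*} [MeasurableSpace X]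
    (μ : Measure X) [IsProbabilityMeasure μ] [TopologicalSpace ι] [FirstCountableTopology ι]
    [TopologicalSpace.SeparableSpace ι] [NormedAddCommGroup H] [InnerProductSpace ℝ H] {n : ℕ}
    (hn : 0 < n) {g : ι → X → ℝ} (hg : ∀ i, AEStronglyMeasurable (g i) μ)
    (hgc : ∀ x, Continuous fun i => g i x)
    (h01 : ∀ i x, g i x ∈ Set.Icc (0 : ℝ) 1) {φ : X → H} (hφ : Integrable (fun x => ‖φ x‖ ^ 2) μ)
    {w : ι → H} {B L δ : ℝ} (hB : ∀ i, ‖w i‖ ≤ B) (hL : 0 ≤ L)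
    (hlip : ∀ i j x, |g i x - g j x| ≤ L * |inner ℝ (w i - w j) (φ x)|) (hδ : 0 < δ)
    (hδ1 : δ ≤ 1) :
    (Measure.pi fun _ : Fin n => μ) {ω | ∃ i, 2 * (L * B * √(n * ∫ x, ‖φ x‖ ^ 2 ∂μ))
      + √(n * Real.log (1 / δ) / 2) < ∑ k, ((∫ x, g i x ∂μ) - g i (ω k))} ≤ ENNReal.ofReal δ := by
  obtain ⟨D, hDc, hDd⟩ := TopologicalSpace.exists_countable_dense ι
  have : Countable D := hDc.to_subtype
  refine (measure_mono ?_).trans (measure_exists_deviation_le μ hn (ι := D) (g := fun i => g i)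
    (w := fun i => w i) (fun i => hg i) (fun i => h01 i) hφ (fun i => hB i) hL
    (fun i j => hlip i j) hδ hδ1)
  rintro ω ⟨i, hi⟩
  have hmean : Continuous fun i => ∫ x, g i x ∂μ := by
    refine continuous_of_dominated hg (bound := fun _ => 1) (fun i => ae_of_all _ fun x => ?_)
      (integrable_const _) (ae_of_all _ hgc)
    rw [Real.norm_eq_abs, abs_of_nonneg (h01 i x).1]
    exact (h01 i x).2
  have hcont : Continuous fun i => ∑ k, ((∫ x, g i x ∂μ) - g i (ω k)) :=
    continuous_finsetSum _ fun k _ => hmean.sub (hgc _)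
  obtain ⟨d, hd, hdD⟩ := hDd.inter_open_nonempty _ (isOpen_lt continuous_const hcont) ⟨i, hi⟩
  exact ⟨⟨d, hdD⟩, hd⟩

theorem Matrix.mulVec_dotProduct_mulVec_of_transpose_mul_self {κ R : Type*} [Fintype κ]
    [DecidableEq κ] [CommRing R] {Q : Matrix κ κ R} (hQ : Q.transpose * Q = 1) (x y : κ → R) :
    Q.mulVec x ⬝ᵥ Q.mulVec y = x ⬝ᵥ y := by
  rw [Matrix.dotProduct_mulVec, Matrix.vecMul_mulVec, hQ, Matrix.vecMul_one]

theorem Fin.sum_dite_lt {M : Type*} [AddCommMonoid M] {r k : ℕ} (h : r ≤ k) (f : Fin r → M) :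
    ∑ i : Fin k, (if hi : (i : ℕ) < r then f ⟨i, hi⟩ else 0) = ∑ j, f j := by
  refine (Fintype.sum_of_injective (Fin.castLE h) (Fin.castLE_injective h) _ _ (fun i hi => ?_)
    fun j => by simp).symm
  rw [dif_neg]
  exact fun hlt => hi ⟨⟨i, hlt⟩, rfl⟩

theorem Fin.sum_ite_lt_const {r s : ℕ} (h : s ≤ r) (a b : ℝ) :
    ∑ j : Fin r, (if (j : ℕ) < s then a else b) = s * a + ((r : ℝ) - s) * b := by
  obtain ⟨d, rfl⟩ := Nat.exists_eq_add_of_le h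
  simp [Fin.sum_univ_add]

theorem integral_sq_gaussianReal_zero (v : NNReal) : ∫ x, x ^ 2 ∂(gaussianReal 0 v) = v := by
  rw [← variance_id_gaussianReal (μ := 0) (v := v),
    variance_of_integral_eq_zero aemeasurable_id (by simp)]
  rfl

theorem integrable_sq_gaussianReal (m : ℝ) (v : NNReal) :
    Integrable (fun x => x ^ 2) (gaussianReal m v) :=
  (memLp_id_gaussianReal 2).integrable_sq

instance sampleMeasure.isProbabilityMeasure (r s : ℕ) (σS σR : ℝ) :
    IsProbabilityMeasure (sampleMeasure r s σS σR) := by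
  unfold sampleMeasure
  infer_instance

theorem dotProduct_featMap {k r s : ℕ} (hrk : r ≤ k) {Q : Matrix (Fin k) (Fin k) ℝ}
    (hQ : Q.transpose * Q = 1) (α β : ℝ) (c z : Fin r → ℝ) :
    ∑ i, Q.mulVec (fun i => if h : (i : ℕ) < r then c ⟨i, h⟩ else 0) i
        * featMap k r s Q α β z i
      = ∑ j : Fin r, c j * ((if (j : ℕ) < s then √α else √β) * z j) := by
  rw [← Fin.sum_dite_lt hrk]
  refine (Matrix.mulVec_dotProduct_mulVec_of_transpose_mul_self hQ _ _).trans ?_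
  refine Finset.sum_congr rfl fun i _ => ?_
  by_cases h : (i : ℕ) < r <;> simp [h]

theorem sum_featMap_sq {k r s : ℕ} (hrk : r ≤ k) {Q : Matrix (Fin k) (Fin k) ℝ}
    (hQ : Q.transpose * Q = 1) {α β : ℝ} (hα : 0 ≤ α) (hβ : 0 ≤ β) (z : Fin r → ℝ) :
    ∑ i, featMap k r s Q α β z i ^ 2
      = ∑ j : Fin r, (if (j : ℕ) < s then α else β) * z j ^ 2 := by
  simp only [pow_two (featMap _ _ _ _ _ _ _ _)]
  refine (dotProduct_featMap hrk hQ α β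
    (fun j => (if (j : ℕ) < s then √α else √β) * z j) z).trans ?_
  refine Finset.sum_congr rfl fun j _ => ?_
  split_ifs
  · linear_combination z j ^ 2 * Real.mul_self_sqrt hα
  · linear_combination z j ^ 2 * Real.mul_self_sqrt hβ

theorem integrable_eval_sq_sampleMeasure (r s : ℕ) (σS σR : ℝ) (j : Fin r) :
    Integrable (fun z : Fin r → ℝ => z j ^ 2) (sampleMeasure r s σS σR) :=
  integrable_comp_eval (μ := fun j : Fin r => gaussianReal 0
    (if (j : ℕ) < s then Real.toNNReal (σS ^ 2) else Real.toNNReal (σR ^ 2)))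
    (f := fun x : ℝ => x ^ 2) (integrable_sq_gaussianReal _ _)

theorem integral_eval_sq_sampleMeasure (r s : ℕ) (σS σR : ℝ) (j : Fin r) :
    ∫ z, z j ^ 2 ∂(sampleMeasure r s σS σR) = if (j : ℕ) < s then σS ^ 2 else σR ^ 2 := by
  refine (integral_comp_eval (μ := fun j : Fin r => gaussianReal 0
    (if (j : ℕ) < s then Real.toNNReal (σS ^ 2) else Real.toNNReal (σR ^ 2)))
    (f := fun x : ℝ => x ^ 2) (integrable_sq_gaussianReal _ _).aestronglyMeasurable).trans ?_
  rw [integral_sq_gaussianReal_zero]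
  split_ifs <;> exact Real.coe_toNNReal _ (sq_nonneg _)

theorem integrable_sum_featMap_sq {k r s : ℕ} (hrk : r ≤ k) {Q : Matrix (Fin k) (Fin k) ℝ}
    (hQ : Q.transpose * Q = 1) {α β : ℝ} (hα : 0 ≤ α) (hβ : 0 ≤ β) (σS σR : ℝ) :
    Integrable (fun z => ∑ i, featMap k r s Q α β z i ^ 2) (sampleMeasure r s σS σR) := by
  simp only [sum_featMap_sq hrk hQ hα hβ]
  exact integrable_finsetSum _ fun j _ =>
    (integrable_eval_sq_sampleMeasure r s σS σR j).const_mul _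

theorem integral_sum_featMap_sq {k r s : ℕ} (hsr : s ≤ r) (hrk : r ≤ k)
    {Q : Matrix (Fin k) (Fin k) ℝ} (hQ : Q.transpose * Q = 1) {α β : ℝ} (hα : 0 ≤ α) (hβ : 0 ≤ β)
    (σS σR : ℝ) :
    ∫ z, ∑ i, featMap k r s Q α β z i ^ 2 ∂(sampleMeasure r s σS σR)
      = s * α * σS ^ 2 + ((r : ℝ) - s) * β * σR ^ 2 := by
  simp only [sum_featMap_sq hrk hQ hα hβ]
  rw [integral_finsetSum _ fun j _ => (integrable_eval_sq_sampleMeasure r s σS σR j).const_mul _,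
    mul_assoc, mul_assoc, ← Fin.sum_ite_lt_const hsr]
  refine Finset.sum_congr rfl fun j _ => ?_
  rw [integral_const_mul, integral_eval_sq_sampleMeasure]
  split_ifs <;> rfl

theorem exists_realizing_predictor {k r : ℕ} (s : ℕ) (hrk : r ≤ k) {Q : Matrix (Fin k) (Fin k) ℝ}
    (hQ : Q.transpose * Q = 1) {α β : ℝ} (hα : 0 < α) (hβ : 0 < β) (ustar : Fin r → ℝ) :
    ∃ u : Fin k → ℝ,
      ∑ i, u i ^ 2 = (∑ j : Fin r, (if (j : ℕ) < s then ustar j ^ 2 else 0)) / α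
        + (∑ j : Fin r, (if (j : ℕ) < s then 0 else ustar j ^ 2)) / β ∧
      ∀ z, ∑ i, u i * featMap k r s Q α β z i = ∑ j, ustar j * z j := by
  refine ⟨Q.mulVec fun i => if h : (i : ℕ) < r then
    (fun j : Fin r => ustar j / if (j : ℕ) < s then √α else √β) ⟨i, h⟩ else 0, ?_, fun z => ?_⟩
  · simp only [pow_two (Q.mulVec _ _)]
    refine (Matrix.mulVec_dotProduct_mulVec_of_transpose_mul_self hQ _ _).trans ?_
    rw [Finset.sum_div, Finset.sum_div, ← Finset.sum_add_distrib, ← Fin.sum_dite_lt hrk]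
    refine Finset.sum_congr rfl fun i _ => ?_
    by_cases h : (i : ℕ) < r
    · by_cases h' : (i : ℕ) < s
      · simp [h, h', div_mul_div_comm, Real.mul_self_sqrt hα.le, pow_two]
      · simp [h, h', div_mul_div_comm, Real.mul_self_sqrt hβ.le, pow_two]
    · simp [h]
  · refine (dotProduct_featMap hrk hQ α β
      (fun j => ustar j / if (j : ℕ) < s then √α else √β) z).trans ?_
    refine Finset.sum_congr rfl fun j _ => ?_
    have := (Real.sqrt_pos.mpr hα).ne'
    have := (Real.sqrt_pos.mpr hβ).ne'
    split_ifs <;> field_simp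

/-- Generalization bound for linear probing on a weighted-feature representation: for an absolute
constant `C > 0`, with probability at least `1 - δ` over the `m` samples the empirical risk
minimizer `û` satisfies the stated excess-risk bound. -/
theorem stmt_8 :
    ∃ C : ℝ, 0 < C ∧
    ∀ (k r s m : ℕ), 1 ≤ s → s < r → r ≤ k → 1 ≤ m →
    ∀ (Q : Matrix (Fin k) (Fin k) ℝ), Q * Q.transpose = 1 → Q.transpose * Q = 1 →
    ∀ (σS σR : ℝ), 0 < σS → 0 < σR →
    ∀ (α β : ℝ), 0 < α → α ≤ 1 → 0 < β → β ≤ 1 →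
    ∀ (ustar : Fin r → ℝ) (v₁ v₂ : ℝ),
      v₁ = ∑ j : Fin r, (if (j : ℕ) < s then ustar j ^ 2 else 0) →
      v₂ = ∑ j : Fin r, (if (j : ℕ) < s then 0 else ustar j ^ 2) →
    ∀ (L : ℝ) (ℓc : ℝ → ℝ → ℝ), 0 ≤ L →
      (∀ y y₁ y₂ : ℝ, |ℓc y₁ y - ℓc y₂ y| ≤ L * |y₁ - y₂|) →
      (∀ p y : ℝ, ℓc p y ∈ Set.Icc (0 : ℝ) 1) →
      (∀ y : ℝ, ℓc y y = 0) →
    ∀ (δ : ℝ), 0 < δ → δ < 1 →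
    ∀ (uhat : (Fin m → Fin r → ℝ) → Fin k → ℝ),
      (∀ ω, ∑ i, uhat ω i ^ 2 ≤ v₁ / α + v₂ / β ∧
        ∀ u : Fin k → ℝ, ∑ i, u i ^ 2 ≤ v₁ / α + v₂ / β →
          1 / (m : ℝ) * ∑ i, ℓc (∑ i', uhat ω i' * featMap k r s Q α β (ω i) i')
              (∑ j, ustar j * ω i j)
            ≤ 1 / (m : ℝ) * ∑ i, ℓc (∑ i', u i' * featMap k r s Q α β (ω i) i')
              (∑ j, ustar j * ω i j)) →
      ENNReal.ofReal (1 - δ) ≤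
        (Measure.pi fun _ : Fin m => sampleMeasure r s σS σR)
          {ω | ∫ z, ℓc (∑ i, uhat ω i * featMap k r s Q α β z i) (∑ j, ustar j * z j)
                  ∂(sampleMeasure r s σS σR)
              ≤ 4 * L * Real.sqrt (1 / (m : ℝ) * (v₁ / α + v₂ / β)) *
                  (Real.sqrt ((s : ℝ) * α * σS ^ 2 + ((r : ℝ) - s) * β * σR ^ 2)
                    + C * Real.sqrt ((max (α * σS ^ 2) (β * σR ^ 2)) ^ 2 * (r : ℝ) /
                        ((s : ℝ) * α * σS ^ 2 + ((r : ℝ) - s) * β * σR ^ 2)))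
                + 8 * Real.sqrt (2 * Real.log (4 / δ) / (m : ℝ))} := by
  refine ⟨1, one_pos, ?_⟩
  intro k r s m hs hsr hrk hm Q _ hQ σS σR hσS hσR α β hα _ hβ _ ustar v₁ v₂ hv₁ hv₂ L ℓc hL hlip h01
    hzero δ hδ hδ1 uhat huhat
  set V := v₁ / α + v₂ / β with hV
  set T := (s : ℝ) * α * σS ^ 2 + ((r : ℝ) - s) * β * σR ^ 2 with hT
  set μ := sampleMeasure r s σS σR with hμ
  let loss : (Fin k → ℝ) → (Fin r → ℝ) → ℝ := fun u z =>
    ℓc (∑ i, u i * featMap k r s Q α β z i) (∑ j, ustar j * z j)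
  let S : Set (Fin k → ℝ) := {u | ∑ i, u i ^ 2 ≤ V ∧ AEStronglyMeasurable (loss u) μ}
  let φ : (Fin r → ℝ) → EuclideanSpace ℝ (Fin k) := fun z => WithLp.toLp 2 (featMap k r s Q α β z)
  have hφ : ∀ z, ‖φ z‖ ^ 2 = ∑ i, featMap k r s Q α β z i ^ 2 := fun z => by
    simp [φ, EuclideanSpace.norm_sq_eq]
  have hφi : Integrable (fun z => ‖φ z‖ ^ 2) μ := by
    simpa only [hφ] using integrable_sum_featMap_sq hrk hQ hα.le hβ.le σS σR
  have hφT : ∫ z, ‖φ z‖ ^ 2 ∂μ = T := by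
    simpa only [hφ] using integral_sum_featMap_sq hsr.le hrk hQ hα.le hβ.le σS σR
  have hT0 : 0 ≤ T := hφT ▸ integral_nonneg fun z => by positivity
  have hlipS : ∀ (u u' : Fin k → ℝ) z, |loss u z - loss u' z|
      ≤ L * |inner ℝ (WithLp.toLp 2 u - WithLp.toLp 2 u') (φ z)| := fun u u' z => by
    refine (hlip _ _ _).trans_eq ?_
    rw [← Finset.sum_sub_distrib]
    congr 2
    simp only [φ, PiLp.inner_apply, PiLp.sub_apply, RCLike.inner_apply, conj_trivial]
    exact Finset.sum_congr rfl fun i _ => by ring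
  have hcont : ∀ z, Continuous fun u => loss u z := fun z => by
    have : ∀ y, Continuous fun p => ℓc p y := fun y =>
      (LipschitzWith.of_dist_le_mul (K := ⟨L, hL⟩) fun a b => hlip y a b).continuous
    exact (this _).comp (by fun_prop)
  have hbad := measure_exists_deviation_le_of_separableSpace μ hm (ι := S)
    (g := fun u => loss u) (w := fun u => WithLp.toLp 2 (u : Fin k → ℝ)) (φ := φ) (B := √V)
    (fun u => u.2.2) (fun z => (hcont z).comp continuous_subtype_val) (fun u z => h01 _ _) hφi
    (fun u => by
      rw [EuclideanSpace.norm_eq]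
      exact Real.sqrt_le_sqrt (by simpa using u.2.1))
    hL (fun u u' => hlipS u u') hδ hδ1.le
  rw [hφT] at hbad
  set good := {ω : Fin m → Fin r → ℝ | ∫ z, loss (uhat ω) z ∂μ
    ≤ 4 * L * √(1 / (m : ℝ) * V) * (√T + 1 * √((max (α * σS ^ 2) (β * σR ^ 2)) ^ 2 * (r : ℝ) / T))
      + 8 * √(2 * Real.log (4 / δ) / (m : ℝ))} with hgood
  change ENNReal.ofReal (1 - δ) ≤ (Measure.pi fun _ : Fin m => μ) good
  have hm0 : (0 : ℝ) < m := by exact_mod_cast hm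
  have hsubset : goodᶜ ⊆ {ω | ∃ u : S, 2 * (L * √V * √(m * T)) + √(m * Real.log (1 / δ) / 2)
      < ∑ k, ((∫ x, loss u x ∂μ) - loss u (ω k))} := by
    intro ω hω
    have hlt := hω
    rw [Set.mem_compl_iff, hgood, Set.mem_ofPred_eq, not_le] at hlt
    have hmeas : AEStronglyMeasurable (loss (uhat ω)) μ := by
      by_contra h
      rw [integral_non_aestronglyMeasurable h] at hlt
      exact hlt.not_ge (by positivity)
    refine ⟨⟨uhat ω, (huhat ω).1, hmeas⟩, ?_⟩
    have hemp : ∑ k, loss (uhat ω) (ω k) ≤ 0 := by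
      obtain ⟨u₀, hu₀, hfit⟩ := exists_realizing_predictor s hrk hQ hα hβ ustar
      have := (huhat ω).2 u₀ (by rw [hu₀, hV, hv₁, hv₂])
      simp only [hfit, hzero, Finset.sum_const_zero, mul_zero] at this
      exact nonpos_of_mul_nonpos_right this (by positivity)
    have hcomplexity : 2 * (L * √V * √(m * T)) ≤ m * (4 * L * √(1 / (m : ℝ) * V) * (√T
        + 1 * √((max (α * σS ^ 2) (β * σR ^ 2)) ^ 2 * (r : ℝ) / T))) := by
      have h1 : m * √(1 / (m : ℝ) * V) = √m * √V := by
        rw [Real.sqrt_mul (by positivity), Real.sqrt_div zero_le_one, Real.sqrt_one]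
        field_simp
        rw [Real.sq_sqrt hm0.le]
      calc _ = 2 * L * (√m * √V) * √T := by rw [Real.sqrt_mul hm0.le]; ring
        _ ≤ 4 * L * (√m * √V) * (√T
            + 1 * √((max (α * σS ^ 2) (β * σR ^ 2)) ^ 2 * (r : ℝ) / T)) := by
          gcongr
          · norm_num
          · exact le_add_of_nonneg_right (by positivity)
        _ = _ := by rw [← h1]; ring
    have hconf : √(m * Real.log (1 / δ) / 2) ≤ m * (8 * √(2 * Real.log (4 / δ) / (m : ℝ))) := by
      have hlog : Real.log (1 / δ) ≤ Real.log (4 / δ) :=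
        Real.log_le_log (by positivity) (by gcongr; norm_num)
      have hlog0 : 0 ≤ Real.log (1 / δ) := Real.log_nonneg (by rw [le_div_iff₀ hδ]; linarith)
      have hlog4 : 0 ≤ Real.log (4 / δ) := hlog0.trans hlog
      refine Real.sqrt_le_iff.mpr ⟨by positivity, ?_⟩
      rw [mul_pow, mul_pow, Real.sq_sqrt (by positivity)]
      field_simp
      nlinarith
    rw [Finset.sum_sub_distrib, Finset.sum_const, Finset.card_univ, Fintype.card_fin,
      nsmul_eq_mul]
    have := mul_lt_mul_of_pos_left hlt hm0
    rw [mul_add] at this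
    linarith
  have hcompl := (measure_mono hsubset).trans hbad
  have hone : (1 : ENNReal) ≤ (Measure.pi fun _ : Fin m => μ) good + ENNReal.ofReal δ := by
    rw [← measure_univ (μ := Measure.pi fun _ : Fin m => μ), ← Set.union_compl_self good]
    exact (measure_union_le _ _).trans (by gcongr)
  rw [ENNReal.ofReal_sub _ hδ.le, ENNReal.ofReal_one]
  exact tsub_le_iff_right.mpr hone
end

section
/- Generalization bound for linear probing on the even-mixture representation (unit variances): there is an absolute constant C > 0 such that with probability at least 1 − δ over the m samples, the empirical risk minimizer û satisfies E_{(z,y)}[ℓ_c(⟪û, ψ(z)⟫, y)] ≤ 4L·√((1/m)·(v₁/α + v₂/β))·(√(s·α + (r−s)·β) + C·√(r/(s·α + (r−s)·β))) + 8·√(2·ln(4/δ)/m). -/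
open MeasureTheory ProbabilityTheory

section Prod
variable {X : Type*} [MeasurableSpace X]

theorem measurePreserving_finCons (μ : Measure X) [IsProbabilityMeasure μ] (m : ℕ) :
    MeasurePreserving (fun p : X × (Fin m → X) => (Fin.cons p.1 p.2 : Fin (m + 1) → X))
      (μ.prod (Measure.pi fun _ : Fin m => μ)) (Measure.pi fun _ : Fin (m + 1) => μ) := by
  have h := (measurePreserving_piFinSuccAbove (fun _ : Fin (m + 1) => μ) 0).symm
  convert h using 1
  ext p : 1
  simp [MeasurableEquiv.piFinSuccAbove, Fin.insertNthEquiv]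

theorem integral_finCons (μ : Measure X) [IsProbabilityMeasure μ] (m : ℕ)
    {g : (Fin (m + 1) → X) → ℝ} (hg : Measurable g) :
    ∫ ω, g ω ∂(Measure.pi fun _ : Fin (m + 1) => μ)
      = ∫ p, g (Fin.cons p.1 p.2) ∂(μ.prod (Measure.pi fun _ : Fin m => μ)) := by
  rw [← (measurePreserving_finCons μ m).map_eq, integral_map]
  · exact (measurePreserving_finCons μ m).measurable.aemeasurable
  · exact hg.aestronglyMeasurable

theorem integral_exp_le_of_bounded_diff (μ : Measure X) [IsProbabilityMeasure μ] (m : ℕ)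
    {g : (Fin m → X) → ℝ} {K c : ℝ} (t : ℝ) (hg : Measurable g) (hK : ∀ x, |g x| ≤ K)
    (hc : ∀ x i y, |g (Function.update x i y) - g x| ≤ c) :
    ∫ x, Real.exp (t * g x) ∂(Measure.pi fun _ : Fin m => μ)
      ≤ Real.exp (t * ∫ x, g x ∂(Measure.pi fun _ : Fin m => μ) + m * (t ^ 2 * c ^ 2 / 2)) := by
  induction m with
  | zero => simp [integral_unique]
  | succ m ih =>
    have hcons := (measurePreserving_finCons μ m).measurable
    have hgc : Measurable fun p : X × (Fin m → X) => g (Fin.cons p.1 p.2) := hg.comp hcons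
    have hgy : ∀ y : Fin m → X, Measurable fun x => g (Fin.cons x y) := fun y =>
      hgc.comp (measurable_id.prodMk measurable_const)
    have hKy : ∀ y : Fin m → X, Integrable (fun x => g (Fin.cons x y)) μ := fun y =>
      Integrable.of_bound (hgy y).aestronglyMeasurable K (.of_forall fun x => hK _)
    have hint : Integrable (fun p : X × (Fin m → X) => g (Fin.cons p.1 p.2))
        (μ.prod (Measure.pi fun _ : Fin m => μ)) :=
      Integrable.of_bound hgc.aestronglyMeasurable K (.of_forall fun x => hK _)
    have hexpb : ∀ x, ‖Real.exp (t * g x)‖ ≤ Real.exp (|t| * K) := fun x => by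
      rw [Real.norm_eq_abs, Real.abs_exp]
      refine Real.exp_le_exp.2 ((le_abs_self _).trans ?_)
      rw [abs_mul]
      exact mul_le_mul_of_nonneg_left (hK x) (abs_nonneg _)
    have hinte : Integrable (fun p : X × (Fin m → X) => Real.exp (t * g (Fin.cons p.1 p.2)))
        (μ.prod (Measure.pi fun _ : Fin m => μ)) :=
      Integrable.of_bound (hgc.const_mul t).exp.aestronglyMeasurable _ (.of_forall fun x => hexpb _)
    set G : (Fin m → X) → ℝ := fun y => ∫ x, g (Fin.cons x y) ∂μ with hG
    have hGm : Measurable G := hgc.stronglyMeasurable.integral_prod_left'.measurable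
    have hGK : ∀ y, |G y| ≤ K := fun y => by
      simpa using norm_integral_le_of_norm_le_const (μ := μ) (f := fun x => g (Fin.cons x y))
        (.of_forall fun x => hK _)
    have hGc : ∀ x i y, |G (Function.update x i y) - G x| ≤ c := fun x i y => by
      rw [hG]
      simp only
      rw [← integral_sub (hKy _) (hKy _)]
      have := norm_integral_le_of_norm_le_const (μ := μ) (C := c)
        (f := fun x' => g (Fin.cons x' (Function.update x i y)) - g (Fin.cons x' x))
        (.of_forall fun x' => by
          rw [Fin.cons_update]
          exact hc _ _ _)
      simpa using this
    have hstep : ∀ y : Fin m → X, ∫ x, Real.exp (t * g (Fin.cons x y)) ∂μ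
        ≤ Real.exp (t * G y) * Real.exp (t ^ 2 * c ^ 2 / 2) := fun y => by
      have : Nonempty X := by
        by_contra hne
        rw [not_nonempty_iff] at hne
        exact IsProbabilityMeasure.ne_zero μ (Measure.eq_zero_of_isEmpty μ)
      obtain ⟨x₀⟩ := this
      have hmem : ∀ x, g (Fin.cons x y) ∈
          Set.Icc (g (Fin.cons x₀ y) - c) (g (Fin.cons x₀ y) + c) := fun x => by
        have h := hc (Fin.cons x₀ y) 0 x
        rw [Fin.update_cons_zero] at h
        constructor <;> linarith [abs_le.1 h]
      have h := (hasSubgaussianMGF_of_mem_Icc (μ := μ) (hgy y).aemeasurable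
        (.of_forall hmem)).mgf_le t
      rw [mgf] at h
      have e : ∀ x, Real.exp (t * g (Fin.cons x y))
          = Real.exp (t * G y) * Real.exp (t * (g (Fin.cons x y) - G y)) := fun x => by
        rw [← Real.exp_add]; ring_nf
      simp_rw [e]
      rw [integral_const_mul]
      refine mul_le_mul_of_nonneg_left (h.trans (le_of_eq ?_)) (Real.exp_pos _).le
      congr 1
      simp only [NNReal.coe_pow, NNReal.coe_div, coe_nnnorm, Real.norm_eq_abs]
      rw [div_pow, sq_abs]
      push_cast
      ring
    have hIH := ih hGm hGK hGc
    have hGint : ∫ y, G y ∂(Measure.pi fun _ : Fin m => μ)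
        = ∫ ω, g ω ∂(Measure.pi fun _ : Fin (m + 1) => μ) := by
      rw [integral_finCons μ m hg, integral_prod_symm _ hint]
    have hexpm : Measurable fun x => Real.exp (t * g x) := (hg.const_mul t).exp
    rw [integral_finCons μ m hexpm, integral_prod_symm _ hinte]
    calc _ ≤ ∫ y, Real.exp (t * G y) * Real.exp (t ^ 2 * c ^ 2 / 2)
            ∂(Measure.pi fun _ : Fin m => μ) := by
          refine integral_mono hinte.integral_prod_right ?_ hstep
          refine (Integrable.of_bound (hGm.const_mul t).exp.aestronglyMeasurable
            (Real.exp (|t| * K)) (.of_forall fun y => ?_)).mul_const _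
          rw [Real.norm_eq_abs, Real.abs_exp]
          refine Real.exp_le_exp.2 ((le_abs_self _).trans ?_)
          rw [abs_mul]
          exact mul_le_mul_of_nonneg_left (hGK y) (abs_nonneg _)
      _ ≤ _ := by
          rw [integral_mul_const]
          refine (mul_le_mul_of_nonneg_right hIH (Real.exp_pos _).le).trans (le_of_eq ?_)
          rw [← Real.exp_add, hGint]
          push_cast
          ring_nf


theorem integrable_ciSup {ι : Type*} [Finite ι] [Nonempty ι] {μ : Measure X} {f : ι → X → ℝ}
    (hf : ∀ i, Integrable (f i) μ) : Integrable (fun x => ⨆ i, f i x) μ := by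
  have := Fintype.ofFinite ι
  refine Integrable.mono' (integrable_finsetSum Finset.univ fun i _ => (hf i).abs)
    (AEMeasurable.iSup fun i => (hf i).aemeasurable).aestronglyMeasurable
    (.of_forall fun x => ?_)
  obtain ⟨i, hi⟩ := exists_eq_ciSup_of_finite (f := fun i => f i x)
  rw [← hi]
  exact Finset.single_le_sum (f := fun i => |f i x|) (fun j _ => abs_nonneg _) (Finset.mem_univ i)

theorem ciSup_add_ciSup_le_of_contraction {ι : Type*} [Finite ι] [Nonempty ι] (h f a : ι → ℝ)
    (hfa : ∀ u v, |f u - f v| ≤ |a u - a v|) :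
    (⨆ u, (h u + 2 * f u)) + (⨆ u, (h u - 2 * f u))
      ≤ (⨆ u, (h u + 2 * a u)) + ⨆ u, (h u - 2 * a u) := by
  obtain ⟨u, hu⟩ := exists_eq_ciSup_of_finite (f := fun u => h u + 2 * f u)
  obtain ⟨v, hv⟩ := exists_eq_ciSup_of_finite (f := fun u => h u - 2 * f u)
  rw [← hu, ← hv]
  have hp : ∀ w, h w + 2 * a w ≤ ⨆ u, (h u + 2 * a u) := fun w =>
    le_ciSup (f := fun u => h u + 2 * a u) (Set.finite_range _).bddAbove w
  have hm : ∀ w, h w - 2 * a w ≤ ⨆ u, (h u - 2 * a u) := fun w =>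
    le_ciSup (f := fun u => h u - 2 * a u) (Set.finite_range _).bddAbove w
  have h1 := (le_abs_self _).trans (hfa u v)
  rcases abs_cases (a u - a v) with h2 | h2
  · linarith [hp u, hm v]
  · linarith [hp v, hm u]

theorem integral_ciSup_sub_le {ι : Type*} [Finite ι] [Nonempty ι] {μ : Measure X}
    [IsProbabilityMeasure μ] {f a : ι → X → ℝ} (hf : ∀ u, Integrable (f u) μ)
    (ha : ∀ u, Integrable (a u) μ) (hfa : ∀ u v x, |f u x - f v x| ≤ |a u x - a v x|)
    {T : X → X} (hT : MeasurePreserving T μ μ) (haT : ∀ u x, a u (T x) = -a u x) (h : ι → ℝ) :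
    ∫ x, ⨆ u, (h u + (∫ x', f u x' ∂μ - f u x)) ∂μ ≤ ∫ x, ⨆ u, (h u + 2 * a u x) ∂μ := by
  have i1 : Integrable (fun x => ⨆ u, (h u + (∫ x', f u x' ∂μ - f u x))) μ :=
    integrable_ciSup fun u => (integrable_const _).add ((integrable_const _).sub (hf u))
  have i2 : Integrable (fun x => ⨆ u, (h u + 2 * f u x)) μ :=
    integrable_ciSup fun u => (integrable_const _).add ((hf u).const_mul 2)
  have i3 : Integrable (fun x => ⨆ u, (h u - 2 * f u x)) μ :=
    integrable_ciSup fun u => (integrable_const _).sub ((hf u).const_mul 2)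
  have i4 : Integrable (fun x => ⨆ u, (h u + 2 * a u x)) μ :=
    integrable_ciSup fun u => (integrable_const _).add ((ha u).const_mul 2)
  have i5 : Integrable (fun x => ⨆ u, (h u - 2 * a u x)) μ :=
    integrable_ciSup fun u => (integrable_const _).sub ((ha u).const_mul 2)
  have hsymm : ∫ x, ⨆ u, (h u - 2 * a u x) ∂μ = ∫ x, ⨆ u, (h u + 2 * a u x) ∂μ := by
    conv_rhs => rw [← hT.map_eq]
    rw [integral_map hT.measurable.aemeasurable]
    · simp_rw [haT, mul_neg, ← sub_eq_add_neg]
    · rw [hT.map_eq]; exact i4.aestronglyMeasurable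
  have hpt : ∀ x, (⨆ u, (h u + (∫ x', f u x' ∂μ - f u x)))
      ≤ 2⁻¹ * (∫ x', ⨆ u, (h u + 2 * f u x') ∂μ) + 2⁻¹ * ⨆ u, (h u - 2 * f u x) := fun x => by
    refine ciSup_le fun u => ?_
    have e1 : h u + 2 * ∫ x', f u x' ∂μ ≤ ∫ x', ⨆ u, (h u + 2 * f u x') ∂μ := by
      have : h u + 2 * ∫ x', f u x' ∂μ = ∫ x', (h u + 2 * f u x') ∂μ := by
        rw [integral_add (integrable_const _) ((hf u).const_mul 2), integral_const_mul]
        simp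
      rw [this]
      exact integral_mono ((integrable_const _).add ((hf u).const_mul 2)) i2 fun x' =>
        le_ciSup (f := fun u => h u + 2 * f u x') (Set.finite_range _).bddAbove u
    have e2 := le_ciSup (f := fun u => h u - 2 * f u x) (Set.finite_range _).bddAbove u
    linarith
  have hle := integral_mono i1 ((integrable_const _).add (i3.const_mul 2⁻¹)) hpt
  have hle2 := integral_mono (i2.add i3) (i4.add i5) fun x =>
    ciSup_add_ciSup_le_of_contraction h (fun u => f u x) (fun u => a u x) fun u v => hfa u v x
  simp only [Pi.add_apply] at hle hle2
  rw [integral_add (integrable_const _) (i3.const_mul 2⁻¹)] at hle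
  rw [integral_add i2 i3, integral_add i4 i5, hsymm] at hle2
  simp only [integral_const, probReal_univ, one_smul] at hle
  rw [integral_const_mul 2⁻¹ fun x => ⨆ u, (h u - 2 * f u x)] at hle
  linarith

theorem integrable_eval {μ : Measure X} [IsProbabilityMeasure μ] {f : X → ℝ} {m : ℕ}
    (hf : Integrable f μ) (i : Fin m) :
    Integrable (fun ω : Fin m → X => f (ω i)) (Measure.pi fun _ : Fin m => μ) :=
  (measurePreserving_eval (fun _ : Fin m => μ) i).integrable_comp_of_integrable hf

theorem integral_ciSup_sum_sub_le {ι : Type*} [Finite ι] [Nonempty ι] {μ : Measure X}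
    [IsProbabilityMeasure μ] {f a : ι → X → ℝ} (hfm : ∀ u, Measurable (f u))
    (ham : ∀ u, Measurable (a u)) (hf : ∀ u, Integrable (f u) μ)
    (ha : ∀ u, Integrable (a u) μ) (hfa : ∀ u v x, |f u x - f v x| ≤ |a u x - a v x|)
    {T : X → X} (hT : MeasurePreserving T μ μ) (haT : ∀ u x, a u (T x) = -a u x) (m : ℕ)
    (h : ι → ℝ) :
    ∫ ω, ⨆ u, (h u + ∑ i, (∫ x', f u x' ∂μ - f u (ω i))) ∂(Measure.pi fun _ : Fin m => μ)
      ≤ ∫ ω, ⨆ u, (h u + ∑ i, 2 * a u (ω i)) ∂(Measure.pi fun _ : Fin m => μ) := by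
  induction m generalizing h with
  | zero => simp
  | succ m ih =>
    set P := Measure.pi fun _ : Fin m => μ with hP
    have j1 : ∀ u, Integrable (fun y : Fin m → X => ∑ i, (∫ x', f u x' ∂μ - f u (y i))) P :=
      fun u => integrable_finsetSum _ fun i _ => (integrable_const _).sub (integrable_eval (hf u) i)
    have j2 : ∀ u, Integrable (fun y : Fin m → X => ∑ i, 2 * a u (y i)) P :=
      fun u => integrable_finsetSum _ fun i _ => (integrable_eval (ha u) i).const_mul 2
    have k1 : Integrable (fun p : X × (Fin m → X) => ⨆ u, (h u +
        (∫ x', f u x' ∂μ - f u p.1 + ∑ i, (∫ x', f u x' ∂μ - f u (p.2 i))))) (μ.prod P) :=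
      integrable_ciSup fun u => (integrable_const _).add
        ((((integrable_const _).sub (hf u)).comp_fst P).add ((j1 u).comp_snd μ))
    have k2 : Integrable (fun p : X × (Fin m → X) => ⨆ u, (h u +
        (2 * a u p.1 + ∑ i, (∫ x', f u x' ∂μ - f u (p.2 i))))) (μ.prod P) :=
      integrable_ciSup fun u => (integrable_const _).add
        ((((ha u).const_mul 2).comp_fst P).add ((j1 u).comp_snd μ))
    have k3 : Integrable (fun p : X × (Fin m → X) => ⨆ u, (h u +
        (2 * a u p.1 + ∑ i, 2 * a u (p.2 i)))) (μ.prod P) :=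
      integrable_ciSup fun u => (integrable_const _).add
        ((((ha u).const_mul 2).comp_fst P).add ((j2 u).comp_snd μ))
    have m1 : Measurable fun ω : Fin (m + 1) → X =>
        ⨆ u, (h u + ∑ i, (∫ x', f u x' ∂μ - f u (ω i))) :=
      Measurable.iSup fun u => by fun_prop
    have m2 : Measurable fun ω : Fin (m + 1) → X => ⨆ u, (h u + ∑ i, 2 * a u (ω i)) :=
      Measurable.iSup fun u => by fun_prop
    rw [integral_finCons μ m m1, integral_finCons μ m m2]
    simp only [Fin.sum_univ_succ, Fin.cons_zero, Fin.cons_succ]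
    calc _ ≤ ∫ p, ⨆ u, (h u + (2 * a u p.1 + ∑ i, (∫ x', f u x' ∂μ - f u (p.2 i))))
            ∂(μ.prod P) := by
          rw [integral_prod_symm _ k1, integral_prod_symm _ k2]
          refine integral_mono k1.integral_prod_right k2.integral_prod_right fun y => ?_
          have := integral_ciSup_sub_le hf ha hfa hT haT
            fun u => h u + ∑ i, (∫ x', f u x' ∂μ - f u (y i))
          simp only [add_assoc, add_comm (∑ i, (∫ x', f _ x' ∂μ - f _ (y i)))] at this
          exact this
      _ ≤ _ := by
          rw [integral_prod _ k2, integral_prod _ k3]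
          refine integral_mono k2.integral_prod_left k3.integral_prod_left fun x => ?_
          have := ih fun u => h u + 2 * a u x
          simp only [add_assoc] at this
          exact this

theorem measure_uniform_deviation_of_finite {ι : Type*} [Finite ι] [Nonempty ι] {μ : Measure X}
    [IsProbabilityMeasure μ] {f a : ι → X → ℝ} (hfm : ∀ u, Measurable (f u))
    (ham : ∀ u, Measurable (a u)) (hf01 : ∀ u x, f u x ∈ Set.Icc (0 : ℝ) 1)
    (ha : ∀ u, Integrable (a u) μ) (hfa : ∀ u v x, |f u x - f v x| ≤ |a u x - a v x|)
    {T : X → X} (hT : MeasurePreserving T μ μ) (haT : ∀ u x, a u (T x) = -a u x) {m : ℕ}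
    (hm : 1 ≤ m) {R t : ℝ} (ht : 0 ≤ t)
    (hR : ∫ ω, ⨆ u, ∑ i, 2 * a u (ω i) ∂(Measure.pi fun _ : Fin m => μ) ≤ R) :
    ENNReal.ofReal (1 - Real.exp (-(m * t ^ 2 / 2))) ≤ (Measure.pi fun _ : Fin m => μ)
      {ω | ∀ u, ∫ x, f u x ∂μ ≤ 1 / (m : ℝ) * ∑ i, f u (ω i) + (R / m + t)} := by
  have hm0 : (0 : ℝ) < m := by exact_mod_cast hm
  have hf : ∀ u, Integrable (f u) μ := fun u =>
    Integrable.of_mem_Icc 0 1 (hfm u).aemeasurable (.of_forall (hf01 u))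
  set P := Measure.pi fun _ : Fin m => μ with hP
  set g : (Fin m → X) → ℝ := fun ω => ⨆ u, 1 / (m : ℝ) * ∑ i, (∫ x, f u x ∂μ - f u (ω i)) with hg
  have hgm : Measurable g := Measurable.iSup fun u => by fun_prop
  have hF01 : ∀ u, ∫ x, f u x ∂μ ∈ Set.Icc (0 : ℝ) 1 := fun u => by
    refine ⟨integral_nonneg fun x => (hf01 u x).1, ?_⟩
    have := integral_mono (hf u) (integrable_const (1 : ℝ)) fun x => (hf01 u x).2
    simpa using this
  have hterm : ∀ u (ω : Fin m → X), 1 / (m : ℝ) * ∑ i, (∫ x, f u x ∂μ - f u (ω i))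
      = ∫ x, f u x ∂μ - 1 / (m : ℝ) * ∑ i, f u (ω i) := fun u ω => by
    rw [Finset.sum_sub_distrib]
    simp only [Finset.sum_const, Finset.card_univ, Fintype.card_fin, nsmul_eq_mul]
    field_simp
  have hle : ∀ u (ω : Fin m → X), 1 / (m : ℝ) * ∑ i, (∫ x, f u x ∂μ - f u (ω i)) ≤ g ω :=
    fun u ω => le_ciSup (f := fun u => 1 / (m : ℝ) * ∑ i, (∫ x, f u x ∂μ - f u (ω i)))
      (Set.finite_range _).bddAbove u
  have hgK : ∀ ω, |g ω| ≤ 1 := fun ω => by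
    obtain ⟨u, hu⟩ := exists_eq_ciSup_of_finite
      (f := fun u => 1 / (m : ℝ) * ∑ i, (∫ x, f u x ∂μ - f u (ω i)))
    simp only [hg]
    rw [← hu, abs_mul, abs_of_nonneg (by positivity), one_div, inv_mul_le_iff₀ hm0, mul_one]
    refine (Finset.abs_sum_le_sum_abs _ _).trans ?_
    refine (Finset.sum_le_card_nsmul _ _ 1 fun i _ => ?_).trans (by simp)
    have h1 := hF01 u
    have h2 := hf01 u (ω i)
    exact abs_le.2 ⟨by linarith [h1.1, h2.2], by linarith [h1.2, h2.1]⟩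
  have hgc1 : ∀ (ω : Fin m → X) i y, g (Function.update ω i y) - g ω ≤ 1 / m := fun ω i y => by
    obtain ⟨u, hu⟩ := exists_eq_ciSup_of_finite
      (f := fun u => 1 / (m : ℝ) * ∑ j, (∫ x, f u x ∂μ - f u (Function.update ω i y j)))
    have h1 := hle u ω
    have h2 : g (Function.update ω i y)
      = 1 / (m : ℝ) * ∑ j, (∫ x, f u x ∂μ - f u (Function.update ω i y j)) := hu.symm
    rw [h2, ← sub_nonneg]
    have h3 : ∑ j, (∫ x, f u x ∂μ - f u (Function.update ω i y j))
        - ∑ j, (∫ x, f u x ∂μ - f u (ω j)) ≤ 1 := by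
      rw [← Finset.sum_sub_distrib, Finset.sum_eq_single i]
      · simp only [Function.update_self]
        linarith [(hf01 u y).1, (hf01 u (ω i)).2]
      · intro j _ hj
        simp [Function.update_of_ne hj]
      · simp
    have h4 := mul_le_mul_of_nonneg_left h3 (by positivity : (0 : ℝ) ≤ 1 / m)
    rw [mul_sub, mul_one] at h4
    linarith
  have hgc : ∀ (ω : Fin m → X) i y, |g (Function.update ω i y) - g ω| ≤ 1 / m := fun ω i y => by
    refine abs_le.2 ⟨?_, hgc1 ω i y⟩
    have := hgc1 (Function.update ω i y) i (ω i)
    rw [Function.update_idem, Function.update_eq_self] at this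
    linarith
  have hmean : ∫ ω, g ω ∂P ≤ R / m := by
    have h := integral_ciSup_sum_sub_le hfm ham hf ha hfa hT haT m fun _ => 0
    simp only [zero_add] at h
    simp only [hg]
    simp_rw [← Real.mul_iSup_of_nonneg (by positivity : (0 : ℝ) ≤ 1 / m)]
    rw [integral_const_mul, div_eq_mul_one_div R, mul_comm R]
    exact mul_le_mul_of_nonneg_left (h.trans hR) (by positivity)
  have hexp := integral_exp_le_of_bounded_diff μ m (m * t) hgm hgK hgc
  have hch := measure_ge_le_exp_mul_mgf (μ := P) (X := g) (t := m * t) (R / m + t) (by positivity)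
    (Integrable.of_bound (hgm.const_mul _).exp.aestronglyMeasurable (Real.exp (m * t * 1))
      (.of_forall fun ω => by
        rw [Real.norm_eq_abs, Real.abs_exp]
        exact Real.exp_le_exp.2 (mul_le_mul_of_nonneg_left ((le_abs_self _).trans (hgK ω))
          (by positivity))))
  have hbad : P.real {ω | R / m + t ≤ g ω} ≤ Real.exp (-(m * t ^ 2 / 2)) := by
    refine hch.trans ((mul_le_mul_of_nonneg_left hexp (Real.exp_pos _).le).trans ?_)
    rw [← Real.exp_add]
    refine Real.exp_le_exp.2 ?_
    have h1 : m * t * ∫ ω, g ω ∂P ≤ m * t * (R / m) :=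
      mul_le_mul_of_nonneg_left hmean (by positivity)
    have h2 : (m : ℝ) * ((m * t) ^ 2 * (1 / m) ^ 2 / 2) = m * t ^ 2 / 2 := by
      field_simp
    rw [h2]
    nlinarith
  have hms : MeasurableSet {ω | R / m + t ≤ g ω} := measurableSet_le measurable_const hgm
  have hgood : 1 - Real.exp (-(m * t ^ 2 / 2)) ≤ P.real {ω | R / m + t ≤ g ω}ᶜ := by
    rw [probReal_compl_eq_one_sub hms]
    linarith
  refine (ENNReal.ofReal_le_ofReal hgood).trans ?_
  rw [ofReal_measureReal]
  refine measure_mono fun ω hω u => ?_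
  have h1 : g ω < R / m + t := not_le.1 hω
  have h2 := hle u ω
  rw [hterm] at h2
  linarith

theorem measure_uniform_deviation_of_measurable {μ : Measure X}
    [IsProbabilityMeasure μ] {f a : ℕ → X → ℝ} (hfm : ∀ u, Measurable (f u))
    (ham : ∀ u, Measurable (a u)) (hf01 : ∀ u x, f u x ∈ Set.Icc (0 : ℝ) 1)
    (ha : ∀ u, Integrable (a u) μ) (hfa : ∀ u v x, |f u x - f v x| ≤ |a u x - a v x|)
    {T : X → X} (hT : MeasurePreserving T μ μ) (haT : ∀ u x, a u (T x) = -a u x) {m : ℕ}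
    (hm : 1 ≤ m) {R t : ℝ} (ht : 0 ≤ t)
    (hR : ∀ n : ℕ, ∫ ω, ⨆ u : Fin (n + 1), ∑ i, 2 * a u (ω i)
      ∂(Measure.pi fun _ : Fin m => μ) ≤ R) :
    ENNReal.ofReal (1 - Real.exp (-(m * t ^ 2 / 2))) ≤ (Measure.pi fun _ : Fin m => μ)
      {ω | ∀ u, ∫ x, f u x ∂μ ≤ 1 / (m : ℝ) * ∑ i, f u (ω i) + (R / m + t)} := by
  set A : ℕ → Set (Fin m → X) := fun n =>
    {ω | ∀ u : Fin (n + 1), ∫ x, f u x ∂μ ≤ 1 / (m : ℝ) * ∑ i, f u (ω i) + (R / m + t)} with hA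
  have hAm : ∀ n, MeasurableSet (A n) := fun n => by
    simp only [hA, Set.ofPred_forall]
    exact MeasurableSet.iInter fun u => measurableSet_le measurable_const (by fun_prop)
  have hanti : Antitone A := fun n n' hn ω hω u => hω ⟨u, by omega⟩
  have hinter : {ω : Fin m → X | ∀ u, ∫ x, f u x ∂μ
      ≤ 1 / (m : ℝ) * ∑ i, f u (ω i) + (R / m + t)} = ⋂ n, A n := by
    ext ω
    simp only [hA, Set.mem_ofPred_eq, Set.mem_iInter]
    exact ⟨fun h n u => h u, fun h u => h u ⟨u, by omega⟩⟩
  rw [hinter]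
  refine ge_of_tendsto' (tendsto_measure_iInter_atTop (fun n => (hAm n).nullMeasurableSet) hanti
    ⟨0, measure_ne_top _ _⟩) fun n => ?_
  exact measure_uniform_deviation_of_finite (f := fun u : Fin (n + 1) => f u)
    (a := fun u : Fin (n + 1) => a u) (fun u => hfm u) (fun u => ham u) (fun u => hf01 u)
    (fun u => ha u) (fun u v => hfa u v) hT (fun u => haT u) hm ht (hR n)

theorem measure_uniform_deviation {μ : Measure X}
    [IsProbabilityMeasure μ] {f a : ℕ → X → ℝ} (hfm : ∀ u, AEMeasurable (f u) μ)
    (ham : ∀ u, Measurable (a u)) (hf01 : ∀ u x, f u x ∈ Set.Icc (0 : ℝ) 1)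
    (ha : ∀ u, Integrable (a u) μ) (hfa : ∀ u v x, |f u x - f v x| ≤ |a u x - a v x|)
    {T : X → X} (hT : MeasurePreserving T μ μ) (haT : ∀ u x, a u (T x) = -a u x) {m : ℕ}
    (hm : 1 ≤ m) {R t : ℝ} (ht : 0 ≤ t)
    (hR : ∀ n : ℕ, ∫ ω, ⨆ u : Fin (n + 1), ∑ i, 2 * a u (ω i)
      ∂(Measure.pi fun _ : Fin m => μ) ≤ R) :
    ENNReal.ofReal (1 - Real.exp (-(m * t ^ 2 / 2))) ≤ (Measure.pi fun _ : Fin m => μ)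
      {ω | ∀ u, ∫ x, f u x ∂μ ≤ 1 / (m : ℝ) * ∑ i, f u (ω i) + (R / m + t)} := by
  set N : Set X := toMeasurable μ {x | ¬ ∀ u, f u x = (hfm u).mk (f u) x} with hN
  have hNm : MeasurableSet N := measurableSet_toMeasurable _ _
  have hN0 : μ N = 0 := by
    rw [hN, measure_toMeasurable]
    exact ae_iff.1 (ae_all_iff.2 fun u => (hfm u).ae_eq_mk)
  set f' : ℕ → X → ℝ := fun u => Nᶜ.indicator (f u) with hf'
  have hfmk : ∀ u, f' u = Nᶜ.indicator ((hfm u).mk (f u)) := fun u => by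
    refine Set.indicator_congr fun x hx => ?_
    by_contra hne
    exact hx (subset_toMeasurable _ _ fun h => hne (h u))
  have hf'm : ∀ u, Measurable (f' u) := fun u => by
    rw [hfmk u]
    exact (hfm u).measurable_mk.indicator hNm.compl
  have hout : ∀ᵐ x ∂μ, ∀ u, f' u x = f u x := by
    filter_upwards [measure_eq_zero_iff_ae_notMem.1 hN0] with x hx u
    exact Set.indicator_of_mem hx _
  have hpi : ∀ᵐ ω ∂(Measure.pi fun _ : Fin m => μ), ∀ i u, f' u (ω i) = f u (ω i) :=
    ae_all_iff.2 fun i =>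
      (measurePreserving_eval (fun _ : Fin m => μ) i).quasiMeasurePreserving.ae hout
  refine (measure_uniform_deviation_of_measurable (f := f') (a := a) hf'm ham (fun u x => ?_) ha
    (fun u v x => ?_) hT haT hm ht hR).trans (measure_mono_ae ?_)
  · by_cases hx : x ∈ Nᶜ
    · simpa [hf', Set.indicator_of_mem hx] using hf01 u x
    · simp [hf', Set.indicator_of_notMem hx]
  · by_cases hx : x ∈ Nᶜ
    · simpa [hf', Set.indicator_of_mem hx] using hfa u v x
    · simp [hf', Set.indicator_of_notMem hx]
  · filter_upwards [hpi] with ω hω h u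
    have h1 := h u
    rw [integral_congr_ae (hout.mono fun x hx => hx u)] at h1
    simpa only [hω] using h1

end Prod

section Gaussian

theorem measurePreserving_neg_pi_gaussianReal (r : ℕ) :
    MeasurePreserving (fun z : Fin r → ℝ => fun j => -z j)
      (Measure.pi fun _ : Fin r => gaussianReal 0 1)
      (Measure.pi fun _ : Fin r => gaussianReal 0 1) :=
  measurePreserving_pi _ _ fun _ => ⟨measurable_neg, by simp [gaussianReal_map_neg]⟩

theorem memLp_eval_pi_gaussianReal (r : ℕ) (j : Fin r) :
    MemLp (fun z : Fin r → ℝ => z j) 2 (Measure.pi fun _ : Fin r => gaussianReal 0 1) :=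
  (memLp_id_gaussianReal (μ := 0) (v := 1) 2).comp_measurePreserving
    (measurePreserving_eval (fun _ : Fin r => gaussianReal 0 1) j)

theorem integral_eval_pi_gaussianReal (r : ℕ) (j : Fin r) :
    ∫ z : Fin r → ℝ, z j ∂(Measure.pi fun _ : Fin r => gaussianReal 0 1) = 0 := by
  rw [integral_comp_eval (μ := fun _ : Fin r => gaussianReal 0 1) (f := fun x : ℝ => x)
    aestronglyMeasurable_id]
  exact integral_id_gaussianReal

theorem variance_eval_pi_gaussianReal (r : ℕ) (j : Fin r) :
    Var[fun z : Fin r → ℝ => z j; Measure.pi fun _ : Fin r => gaussianReal 0 1] = 1 := by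
  have h := (measurePreserving_eval (fun _ : Fin r => gaussianReal 0 1) j).variance_fun_comp
    (f := fun x : ℝ => x) aemeasurable_id
  rw [variance_fun_id_gaussianReal] at h
  simpa using h

theorem memLp_sum_eval (m r : ℕ) (j : Fin r) :
    MemLp (fun ω : Fin m → Fin r → ℝ => ∑ i, ω i j) 2
      (Measure.pi fun _ : Fin m => Measure.pi fun _ : Fin r => gaussianReal 0 1) :=
  memLp_finsetSum _ fun i _ => (memLp_eval_pi_gaussianReal r j).comp_measurePreserving
    (measurePreserving_eval (fun _ : Fin m => Measure.pi fun _ : Fin r => gaussianReal 0 1) i)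

theorem integral_sum_eval_sq (m r : ℕ) (j : Fin r) :
    ∫ ω : Fin m → Fin r → ℝ, (∑ i, ω i j) ^ 2
      ∂(Measure.pi fun _ : Fin m => Measure.pi fun _ : Fin r => gaussianReal 0 1) = m := by
  have hv := variance_sum_pi
    (μ := fun _ : Fin m => Measure.pi fun _ : Fin r => gaussianReal 0 1)
    (X := fun (_ : Fin m) (z : Fin r → ℝ) => z j) fun _ => memLp_eval_pi_gaussianReal r j
  have e : (∑ i : Fin m, fun ω : Fin m → Fin r → ℝ => ω i j) = fun ω => ∑ i, ω i j := by
    ext ω; simp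
  have h0 : ∫ ω : Fin m → Fin r → ℝ, ∑ i, ω i j
      ∂(Measure.pi fun _ : Fin m => Measure.pi fun _ : Fin r => gaussianReal 0 1) = 0 := by
    rw [integral_finsetSum]
    · refine Finset.sum_eq_zero fun i _ => ?_
      rw [integral_comp_eval
        (μ := fun _ : Fin m => Measure.pi fun _ : Fin r => gaussianReal 0 1)
        (f := fun z : Fin r → ℝ => z j) (measurable_pi_apply j).aestronglyMeasurable]
      exact integral_eval_pi_gaussianReal r j
    · exact fun i _ => integrable_eval ((memLp_eval_pi_gaussianReal r j).integrable one_le_two) i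
  simp only [e, variance_eval_pi_gaussianReal] at hv
  rw [variance_of_integral_eq_zero (memLp_sum_eval m r j).aemeasurable h0] at hv
  simpa using hv

theorem integral_sqrt_sum_sq_le (m r : ℕ) (d : Fin r → ℝ) :
    Integrable (fun ω : Fin m → Fin r → ℝ => √(∑ j, (d j * ∑ i, ω i j) ^ 2))
      (Measure.pi fun _ : Fin m => Measure.pi fun _ : Fin r => gaussianReal 0 1) ∧
    ∫ ω : Fin m → Fin r → ℝ, √(∑ j, (d j * ∑ i, ω i j) ^ 2)
      ∂(Measure.pi fun _ : Fin m => Measure.pi fun _ : Fin r => gaussianReal 0 1)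
      ≤ √(m * ∑ j, d j ^ 2) := by
  set P := Measure.pi fun _ : Fin m => Measure.pi fun _ : Fin r => gaussianReal 0 1
  have hj : ∀ j, Integrable (fun ω : Fin m → Fin r → ℝ => (d j * ∑ i, ω i j) ^ 2) P := fun j =>
    ((memLp_sum_eval m r j).const_mul (d j)).integrable_sq
  have hY : Integrable (fun ω : Fin m → Fin r → ℝ => ∑ j, (d j * ∑ i, ω i j) ^ 2) P :=
    integrable_finsetSum _ fun j _ => hj j
  have hs : Integrable (fun ω : Fin m → Fin r → ℝ => √(∑ j, (d j * ∑ i, ω i j) ^ 2)) P := by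
    refine Integrable.mono' ((integrable_const (1 : ℝ)).add hY)
      (Measurable.aestronglyMeasurable (by fun_prop)) (.of_forall fun ω => ?_)
    rw [Real.norm_eq_abs, abs_of_nonneg (Real.sqrt_nonneg _)]
    simp only [Pi.add_apply]
    have h0 : 0 ≤ ∑ j, (d j * ∑ i, ω i j) ^ 2 := Finset.sum_nonneg fun j _ => sq_nonneg _
    nlinarith [Real.sq_sqrt h0, Real.sqrt_nonneg (∑ j, (d j * ∑ i, ω i j) ^ 2)]
  refine ⟨hs, ?_⟩
  have hJ := Real.strictConcaveOn_sqrt.concaveOn.le_map_integral (μ := P)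
    Real.continuous_sqrt.continuousOn isClosed_Ici
    (.of_forall fun ω => Finset.sum_nonneg fun j _ => sq_nonneg (d j * ∑ i, ω i j)) hY hs
  refine hJ.trans (le_of_eq ?_)
  congr 1
  rw [integral_finsetSum _ fun j _ => hj j, Finset.mul_sum]
  refine Finset.sum_congr rfl fun j _ => ?_
  simp only [mul_pow]
  rw [integral_const_mul, integral_sum_eval_sq, mul_comm]

theorem integral_ciSup_linear_le {ι : Type*} [Finite ι] [Nonempty ι] (m r : ℕ)
    (d : Fin r → ℝ) {L V : ℝ} (hL : 0 ≤ L) (w : ι → Fin r → ℝ) (hw : ∀ u, ∑ j, w u j ^ 2 ≤ V) :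
    ∫ ω : Fin m → Fin r → ℝ, ⨆ u, ∑ i, 2 * (L * ∑ j, w u j * (d j * ω i j))
      ∂(Measure.pi fun _ : Fin m => Measure.pi fun _ : Fin r => gaussianReal 0 1)
      ≤ 2 * L * √V * √(m * ∑ j, d j ^ 2) := by
  obtain ⟨hs, hsle⟩ := integral_sqrt_sum_sq_le m r d
  refine le_trans ?_ (mul_le_mul_of_nonneg_left hsle
    (mul_nonneg (mul_nonneg zero_le_two hL) (Real.sqrt_nonneg _)))
  rw [← integral_const_mul]
  refine integral_mono ?_ (hs.const_mul _) fun ω => ciSup_le fun u => ?_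
  · refine integrable_ciSup fun u => integrable_finsetSum _ fun i _ => Integrable.const_mul
      (Integrable.const_mul (integrable_finsetSum _ fun j _ =>
        Integrable.const_mul (Integrable.const_mul ?_ _) _) _) _
    exact integrable_eval ((memLp_eval_pi_gaussianReal r j).integrable one_le_two) i
  · have e : ∑ i, 2 * (L * ∑ j, w u j * (d j * ω i j))
        = 2 * L * ∑ j, w u j * (d j * ∑ i, ω i j) := by
      simp only [Finset.mul_sum]
      rw [Finset.sum_comm]
      exact Finset.sum_congr rfl fun j _ => Finset.sum_congr rfl fun i _ => by ring
    rw [e, mul_assoc (2 * L)]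
    refine mul_le_mul_of_nonneg_left ?_ (by positivity)
    refine (Real.sum_mul_le_sqrt_mul_sqrt _ _ _).trans ?_
    exact mul_le_mul_of_nonneg_right (Real.sqrt_le_sqrt (hw u)) (Real.sqrt_nonneg _)

theorem measure_linear_class_deviation {m r : ℕ} (hm : 1 ≤ m) (d ustar : Fin r → ℝ) {L V t : ℝ}
    (hL : 0 ≤ L) (ht : 0 ≤ t) {ℓc : ℝ → ℝ → ℝ}
    (hlip : ∀ y y₁ y₂ : ℝ, |ℓc y₁ y - ℓc y₂ y| ≤ L * |y₁ - y₂|)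
    (h01 : ∀ p y : ℝ, ℓc p y ∈ Set.Icc (0 : ℝ) 1) :
    ENNReal.ofReal (1 - Real.exp (-(m * t ^ 2 / 2))) ≤
      (Measure.pi fun _ : Fin m => Measure.pi fun _ : Fin r => gaussianReal 0 1)
      {ω | ∀ w : Fin r → ℝ, ∑ j, w j ^ 2 ≤ V →
        ∫ z, ℓc (∑ j, w j * (d j * z j)) (∑ j, ustar j * z j)
            ∂(Measure.pi fun _ : Fin r => gaussianReal 0 1)
          ≤ 1 / (m : ℝ) * ∑ i, ℓc (∑ j, w j * (d j * ω i j)) (∑ j, ustar j * ω i j)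
            + (2 * L * √V * √(m * ∑ j, d j ^ 2) / m + t)} := by
  set μ := Measure.pi fun _ : Fin r => gaussianReal 0 1 with hμ
  have hslack : 0 ≤ 2 * L * √V * √(m * ∑ j, d j ^ 2) / m + t := by positivity
  set G : Set (Fin r → ℝ) := {w | ∑ j, w j ^ 2 ≤ V ∧
    AEStronglyMeasurable (fun z => ℓc (∑ j, w j * (d j * z j)) (∑ j, ustar j * z j)) μ} with hG
  have hemp : ∀ (w : Fin r → ℝ) (ω : Fin m → Fin r → ℝ), (0 : ℝ)
      ≤ 1 / (m : ℝ) * ∑ i, ℓc (∑ j, w j * (d j * ω i j)) (∑ j, ustar j * ω i j) := fun w ω =>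
    mul_nonneg (by positivity) (Finset.sum_nonneg fun i _ => (h01 _ _).1)
  have hout : ∀ (w : Fin r → ℝ) (ω : Fin m → Fin r → ℝ), ∑ j, w j ^ 2 ≤ V → w ∉ G →
      ∫ z, ℓc (∑ j, w j * (d j * z j)) (∑ j, ustar j * z j) ∂μ
          ≤ 1 / (m : ℝ) * ∑ i, ℓc (∑ j, w j * (d j * ω i j)) (∑ j, ustar j * ω i j)
            + (2 * L * √V * √(m * ∑ j, d j ^ 2) / m + t) := fun w ω hw hwG => by
    rw [integral_undef fun h => hwG ⟨hw, h.aestronglyMeasurable⟩]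
    exact add_nonneg (hemp w ω) hslack
  rcases G.eq_empty_or_nonempty with hGe | hGne
  · refine le_trans (ENNReal.ofReal_le_ofReal (sub_le_self _ (Real.exp_pos _).le)) ?_
    rw [ENNReal.ofReal_one, ← measure_univ (μ := Measure.pi fun _ : Fin m => μ)]
    exact measure_mono fun ω _ w hw => hout w ω hw (by simp [hGe])
  have : Nonempty G := hGne.to_subtype
  have hlc : ∀ y, Continuous fun p => ℓc p y := fun y =>
    (LipschitzWith.of_dist_le_mul (K := ⟨L, hL⟩) fun p q => hlip y p q).continuous
  have hcont : ∀ ω : Fin m → Fin r → ℝ, Continuous fun w : G =>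
      ∫ z, ℓc (∑ j, w.1 j * (d j * z j)) (∑ j, ustar j * z j) ∂μ
        - 1 / (m : ℝ) * ∑ i, ℓc (∑ j, w.1 j * (d j * ω i j)) (∑ j, ustar j * ω i j) := fun ω => by
    have hlin : ∀ z : Fin r → ℝ, Continuous fun w : G =>
        ℓc (∑ j, w.1 j * (d j * z j)) (∑ j, ustar j * z j) := fun z =>
      (hlc (∑ j, ustar j * z j)).comp (continuous_finsetSum _ fun j _ =>
        ((continuous_apply j).comp continuous_subtype_val).mul continuous_const)
    refine Continuous.sub ?_ (continuous_const.mul (continuous_finsetSum _ fun i _ => hlin _))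
    refine continuous_of_dominated (bound := fun _ => (1 : ℝ)) (fun w => w.2.2)
      (fun w => .of_forall fun z => ?_) (integrable_const _) (.of_forall hlin)
    rw [Real.norm_eq_abs, abs_of_nonneg (h01 _ _).1]
    exact (h01 _ _).2
  set W : ℕ → G := TopologicalSpace.denseSeq G with hW
  have hai : ∀ w : Fin r → ℝ, Integrable (fun z : Fin r → ℝ => L * ∑ j, w j * (d j * z j)) μ :=
    fun w => (integrable_finsetSum _ fun j _ => ((((memLp_eval_pi_gaussianReal r j).integrable
      one_le_two).const_mul (d j)).const_mul (w j))).const_mul L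
  refine (measure_uniform_deviation
    (f := fun n z => ℓc (∑ j, (W n).1 j * (d j * z j)) (∑ j, ustar j * z j))
    (a := fun n z => L * ∑ j, (W n).1 j * (d j * z j))
    (fun n => (W n).2.2.aemeasurable) (fun n => by fun_prop) (fun n z => h01 _ _)
    (fun n => hai _) (fun u v z => ?_) (measurePreserving_neg_pi_gaussianReal r)
    (fun u z => by simp) hm ht
    (fun n => integral_ciSup_linear_le m r d hL (fun u : Fin (n + 1) => (W u).1)
      fun u => (W u).2.1)).trans (measure_mono fun ω hω w hw => ?_)
  · rw [← mul_sub, abs_mul, abs_of_nonneg hL]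
    exact hlip _ _ _
  · by_cases hwG : w ∈ G
    · have h := (TopologicalSpace.denseRange_denseSeq G).induction_on
        (p := fun w : G => ∫ z, ℓc (∑ j, w.1 j * (d j * z j)) (∑ j, ustar j * z j) ∂μ
          - 1 / (m : ℝ) * ∑ i, ℓc (∑ j, w.1 j * (d j * ω i j)) (∑ j, ustar j * ω i j)
          ≤ 2 * L * √V * √(m * ∑ j, d j ^ 2) / m + t) ⟨w, hwG⟩
        (isClosed_le (hcont ω) continuous_const) fun n => by
          have := hω n
          linarith
      simp only at h
      linarith
    · exact hout w ω hw hwG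

end Gaussian

section FeatureMap

open Matrix

theorem sum_mul_featMap {k r : ℕ} (s : ℕ) (hrk : r ≤ k) (Q : Matrix (Fin k) (Fin k) ℝ)
    (α β : ℝ) (u : Fin k → ℝ) (z : Fin r → ℝ) :
    ∑ i, u i * featMap k r s Q α β z i
      = ∑ j : Fin r, (u ᵥ* Q) (Fin.castLE hrk j)
        * ((if (j : ℕ) < s then Real.sqrt α else Real.sqrt β) * z j) := by
  change u ⬝ᵥ featMap k r s Q α β z = _
  rw [featMap, dotProduct_mulVec]
  refine (Fintype.sum_of_injective (Fin.castLE hrk) (Fin.castLE_injective hrk) _ _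
    (fun i hi => ?_) fun j => ?_).symm
  · simp only
    rw [dif_neg fun h => hi ⟨⟨i, h⟩, rfl⟩, mul_zero]
  · simp

theorem sum_sq_vecMul_castLE_le {k r : ℕ} (hrk : r ≤ k) {Q : Matrix (Fin k) (Fin k) ℝ}
    (hQ : Q * Qᵀ = 1) (u : Fin k → ℝ) :
    ∑ j : Fin r, (u ᵥ* Q) (Fin.castLE hrk j) ^ 2 ≤ ∑ i, u i ^ 2 := by
  have h : ∑ i, (u ᵥ* Q) i ^ 2 = ∑ i, u i ^ 2 := by
    have : (u ᵥ* Q) ⬝ᵥ (u ᵥ* Q) = u ⬝ᵥ u := by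
      rw [← dotProduct_mulVec, ← mulVec_transpose, mulVec_mulVec, hQ, one_mulVec]
    simpa [dotProduct, sq] using this
  rw [← h, ← Finset.sum_image (f := fun i => (u ᵥ* Q) i ^ 2) (s := Finset.univ)
    fun a _ b _ hab => Fin.castLE_injective hrk hab]
  exact Finset.sum_le_sum_of_subset_of_nonneg (Finset.subset_univ _) fun _ _ _ => sq_nonneg _

theorem exists_linear_probe {k r : ℕ} (s : ℕ) (hrk : r ≤ k) {Q : Matrix (Fin k) (Fin k) ℝ}
    (hQ : Qᵀ * Q = 1) {α β : ℝ} (hα : 0 < α) (hβ : 0 < β) (ustar : Fin r → ℝ) :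
    ∃ u : Fin k → ℝ,
      ∑ i, u i ^ 2 = (∑ j : Fin r, if (j : ℕ) < s then ustar j ^ 2 else 0) / α
        + (∑ j : Fin r, if (j : ℕ) < s then 0 else ustar j ^ 2) / β ∧
      ∀ z, ∑ i, u i * featMap k r s Q α β z i = ∑ j, ustar j * z j := by
  set φ : Fin k → ℝ := fun i => if h : (i : ℕ) < r then
    ustar ⟨i, h⟩ / (if (i : ℕ) < s then Real.sqrt α else Real.sqrt β) else 0 with hφ
  have hφQ : (Q *ᵥ φ) ᵥ* Q = φ := by
    rw [← mulVec_transpose, mulVec_mulVec, hQ, one_mulVec]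
  refine ⟨Q *ᵥ φ, ?_, fun z => ?_⟩
  · have h1 : ∑ i, (Q *ᵥ φ) i ^ 2 = ∑ i, φ i ^ 2 := by
      have : (Q *ᵥ φ) ⬝ᵥ (Q *ᵥ φ) = φ ⬝ᵥ φ := by rw [dotProduct_mulVec, hφQ]
      simpa [dotProduct, sq] using this
    rw [h1, Finset.sum_div, Finset.sum_div, ← Finset.sum_add_distrib]
    refine (Fintype.sum_of_injective (Fin.castLE hrk) (Fin.castLE_injective hrk) _ _
      (fun i hi => ?_) fun j => ?_).symm
    · simp only [hφ]
      rw [dif_neg fun h => hi ⟨⟨i, h⟩, rfl⟩]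
      simp
    · by_cases hj : (j : ℕ) < s
      · simp [hφ, hj, div_pow, Real.sq_sqrt hα.le]
      · simp [hφ, hj, div_pow, Real.sq_sqrt hβ.le]
  · rw [sum_mul_featMap s hrk, hφQ]
    refine Finset.sum_congr rfl fun j _ => ?_
    have hα' := (Real.sqrt_pos.2 hα).ne'
    have hβ' := (Real.sqrt_pos.2 hβ).ne'
    by_cases hj : (j : ℕ) < s
    · simp only [hφ, Fin.val_castLE, j.2, hj, dite_true, if_true]
      field_simp
    · simp only [hφ, Fin.val_castLE, j.2, hj, dite_true, if_false]
      field_simp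

theorem sum_sq_weights {r s : ℕ} (hsr : s ≤ r) {α β : ℝ} (hα : 0 ≤ α) (hβ : 0 ≤ β) :
    ∑ j : Fin r, (if (j : ℕ) < s then Real.sqrt α else Real.sqrt β) ^ 2
      = (s : ℝ) * α + ((r : ℝ) - s) * β := by
  simp only [ite_pow, Real.sq_sqrt hα, Real.sq_sqrt hβ]
  obtain ⟨c, rfl⟩ := Nat.exists_eq_add_of_le hsr
  rw [Fin.sum_univ_add]
  simp

end FeatureMap

/-- Generalization bound for linear probing on the even-mixture representation (unit variances):
for an absolute constant `C > 0`, with probability at least `1 - δ` over the `m` standard-Gaussian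
samples the empirical risk minimizer `û` satisfies the stated excess-risk bound. -/
theorem stmt_10 :
    ∃ C : ℝ, 0 < C ∧
    ∀ (k r s m : ℕ), 1 ≤ s → s < r → r ≤ k → 1 ≤ m →
    ∀ (Q : Matrix (Fin k) (Fin k) ℝ), Q * Q.transpose = 1 → Q.transpose * Q = 1 →
    ∀ (α β : ℝ), 0 < α → α ≤ 1 → 0 < β → β ≤ 1 →
    ∀ (ustar : Fin r → ℝ) (v₁ v₂ : ℝ),
      v₁ = ∑ j : Fin r, (if (j : ℕ) < s then ustar j ^ 2 else 0) →
      v₂ = ∑ j : Fin r, (if (j : ℕ) < s then 0 else ustar j ^ 2) →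
    ∀ (L : ℝ) (ℓc : ℝ → ℝ → ℝ), 0 ≤ L →
      (∀ y y₁ y₂ : ℝ, |ℓc y₁ y - ℓc y₂ y| ≤ L * |y₁ - y₂|) →
      (∀ p y : ℝ, ℓc p y ∈ Set.Icc (0 : ℝ) 1) →
      (∀ y : ℝ, ℓc y y = 0) →
    ∀ (δ : ℝ), 0 < δ → δ < 1 →
    ∀ (uhat : (Fin m → Fin r → ℝ) → Fin k → ℝ),
      (∀ ω, ∑ i, uhat ω i ^ 2 ≤ v₁ / α + v₂ / β ∧
        ∀ u : Fin k → ℝ, ∑ i, u i ^ 2 ≤ v₁ / α + v₂ / β →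
          1 / (m : ℝ) * ∑ i, ℓc (∑ i', uhat ω i' * featMap k r s Q α β (ω i) i')
              (∑ j, ustar j * ω i j)
            ≤ 1 / (m : ℝ) * ∑ i, ℓc (∑ i', u i' * featMap k r s Q α β (ω i) i')
              (∑ j, ustar j * ω i j)) →
      ENNReal.ofReal (1 - δ) ≤
        (Measure.pi fun _ : Fin m => (Measure.pi fun _ : Fin r => gaussianReal 0 1))
          {ω | ∫ z, ℓc (∑ i, uhat ω i * featMap k r s Q α β z i) (∑ j, ustar j * z j)
                  ∂(Measure.pi fun _ : Fin r => gaussianReal 0 1)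
              ≤ 4 * L * Real.sqrt (1 / (m : ℝ) * (v₁ / α + v₂ / β)) *
                  (Real.sqrt ((s : ℝ) * α + ((r : ℝ) - s) * β)
                    + C * Real.sqrt ((r : ℝ) / ((s : ℝ) * α + ((r : ℝ) - s) * β)))
                + 8 * Real.sqrt (2 * Real.log (4 / δ) / (m : ℝ))} := by
  refine ⟨1, one_pos, ?_⟩
  intro k r s m _ hsr hrk hm Q hQ hQ' α β hα _ hβ _ ustar v₁ v₂ hv₁ hv₂ L ℓc hL hlip h01 hzero
    δ hδ hδ1 uhat hu
  have hm0 : (0 : ℝ) < m := by exact_mod_cast hm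
  set V := v₁ / α + v₂ / β with hV
  set D := (s : ℝ) * α + ((r : ℝ) - s) * β with hD
  set d : Fin r → ℝ := fun j => if (j : ℕ) < s then Real.sqrt α else Real.sqrt β with hd
  have hdD : ∑ j, d j ^ 2 = D := sum_sq_weights hsr.le hα.le hβ.le
  set t := 8 * Real.sqrt (2 * Real.log (4 / δ) / (m : ℝ)) with ht
  have hlog : 0 ≤ Real.log (4 / δ) :=
    Real.log_nonneg ((one_le_div hδ).2 (by linarith))
  have hexp : Real.exp (-(m * t ^ 2 / 2)) ≤ δ := by
    have e : m * t ^ 2 / 2 = 64 * Real.log (4 / δ) := by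
      rw [ht, mul_pow, Real.sq_sqrt (by positivity)]
      field_simp
      ring
    calc Real.exp (-(m * t ^ 2 / 2)) ≤ Real.exp (-Real.log (4 / δ)) :=
          Real.exp_le_exp.2 (by rw [e]; linarith)
      _ = δ / 4 := by rw [Real.exp_neg, Real.exp_log (by positivity), inv_div]
      _ ≤ δ := by linarith
  refine (ENNReal.ofReal_le_ofReal (sub_le_sub_left hexp 1)).trans
    ((measure_linear_class_deviation (V := V) hm d ustar hL (by positivity) hlip h01).trans
      (measure_mono fun ω hω => ?_))
  obtain ⟨u₀, hu₀, hpred⟩ := exists_linear_probe s hrk hQ' hα hβ ustar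
  rw [← hv₁, ← hv₂] at hu₀
  have hfit : 1 / (m : ℝ) * ∑ i, ℓc (∑ i', uhat ω i' * featMap k r s Q α β (ω i) i')
      (∑ j, ustar j * ω i j) ≤ 0 := by
    refine ((hu ω).2 u₀ hu₀.le).trans (le_of_eq ?_)
    simp [hpred, hzero]
  have hdev := hω (fun j => (Matrix.vecMul (uhat ω) Q) (Fin.castLE hrk j))
    ((sum_sq_vecMul_castLE_le hrk hQ (uhat ω)).trans (hu ω).1)
  simp only [sum_mul_featMap s hrk] at hfit
  simp only [Set.mem_ofPred_eq, sum_mul_featMap s hrk]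
  refine (hdev.trans (add_le_add_left hfit _)).trans ?_
  rw [zero_add]
  refine add_le_add_left ?_ _
  have hR : 2 * L * √V * √(m * ∑ j, d j ^ 2) / m = 2 * L * √(1 / (m : ℝ) * V) * √D := by
    rw [hdD, Real.sqrt_mul hm0.le, Real.sqrt_mul (by positivity), one_div, Real.sqrt_inv]
    have h1 := (Real.sqrt_pos.2 hm0).ne'
    field_simp
    rw [Real.sq_sqrt hm0.le]
    ring
  rw [hR]
  have h1 : 0 ≤ L * √(1 / (m : ℝ) * V) := by positivity
  have h2 : 0 ≤ √D := Real.sqrt_nonneg _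
  have h3 : 0 ≤ √((r : ℝ) / D) := Real.sqrt_nonneg _
  nlinarith [mul_nonneg h1 h2, mul_nonneg h1 h3]
end

section
/- For two independent χ²_s random variables Z and Z₁, a convex, decreasing, bounded-below loss ℓ, and any T ≥ 1, the function α ↦ E[ℓ(α·Z + ((2−α)/T)·Z₁)] on [0,1] attains its minimum at α = 1; that is, for every α ∈ [0,1], E[ℓ(Z + (1/T)·Z₁)] ≤ E[ℓ(α·Z + ((2−α)/T)·Z₁)]. -/
open MeasureTheory ProbabilityTheory

/-- A finite product of measures with integrable nonnegative densities has the product density. -/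
lemma pi_withDensity_ofReal {ι α : Type*} [Fintype ι] [MeasurableSpace α] (μ : Measure α)
    [SigmaFinite μ] {f : α → ℝ} (hf : Integrable f μ) (hf0 : ∀ x, 0 ≤ f x) :
    Measure.pi (fun _ : ι => μ.withDensity fun x => ENNReal.ofReal (f x)) =
      (Measure.pi fun _ : ι => μ).withDensity fun x => ENNReal.ofReal (∏ i, f (x i)) := by
  have : SigmaFinite (μ.withDensity fun x => ENNReal.ofReal (f x)) :=
    SigmaFinite.withDensity_ofReal f
  refine Measure.pi_eq fun A hA => ?_
  rw [withDensity_apply _ (.univ_pi hA), Measure.restrict_pi_pi,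
    ← ofReal_integral_eq_lintegral_ofReal (Integrable.fintype_prod fun i => hf.restrict)
      (.of_forall fun x => Finset.prod_nonneg fun i _ => hf0 _),
    integral_fintype_prod_eq_prod (fun _ => f),
    ENNReal.ofReal_prod_of_nonneg fun i _ => integral_nonneg hf0]
  refine Finset.prod_congr rfl fun i _ => ?_
  rw [withDensity_apply _ (hA i),
    ofReal_integral_eq_lintegral_ofReal hf.restrict (.of_forall hf0)]

/-- The density of a centred isotropic Gaussian vector with coordinate variance `v`. -/
lemma prod_gaussianPDFReal {ι : Type*} [Fintype ι] (v : NNReal) (x : ι → ℝ) :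
    ∏ i, gaussianPDFReal 0 v (x i) =
      (√(2 * Real.pi * v))⁻¹ ^ Fintype.card ι * Real.exp (-(∑ i, x i ^ 2) / (2 * v)) := by
  simp only [gaussianPDFReal_def, sub_zero, Finset.prod_mul_distrib, Finset.prod_const,
    ← Real.exp_sum, Finset.card_univ, ← Finset.sum_div, Finset.sum_neg_distrib]

lemma pi_gaussianReal_eq_withDensity {ι : Type*} [Fintype ι] {v : NNReal} (hv : v ≠ 0) :
    Measure.pi (fun _ : ι => gaussianReal 0 v) =
      (volume : Measure (ι → ℝ)).withDensity
        fun x => ENNReal.ofReal (∏ i, gaussianPDFReal 0 v (x i)) := by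
  rw [gaussianReal_of_var_ne_zero _ hv]
  exact pi_withDensity_ofReal volume (integrable_gaussianPDFReal 0 v)
    (gaussianPDFReal_nonneg 0 v)

/-- If the symmetrization of a function on a square is nonnegative, then so is its integral. -/
lemma integral_prod_nonneg_of_add_swap_nonneg {α : Type*} [MeasurableSpace α] {μ : Measure α}
    [SFinite μ] {f : α × α → ℝ} (hf : Integrable f (μ.prod μ))
    (h : ∀ z, 0 ≤ f z + f z.swap) : 0 ≤ ∫ z, f z ∂μ.prod μ := by
  have h2 : 0 ≤ ∫ z, (f z + f z.swap) ∂μ.prod μ := integral_nonneg h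
  have h3 := integral_prod_swap (μ := μ) (ν := μ) f
  have h4 : Integrable (fun z : α × α => f z.swap) (μ.prod μ) := hf.swap
  rw [integral_add hf h4, h3] at h2
  linarith

lemma convex_antitone_weighted_swap_nonneg {ℓ : ℝ → ℝ} (hconv : ConvexOn ℝ Set.univ ℓ)
    (hanti : Antitone ℓ) {α : ℝ} (hα1 : α ≤ 1) {u v w w' : ℝ} (hvu : v ≤ u)
    (hw' : 0 ≤ w') (hw : w' ≤ w) :
    0 ≤ w * (ℓ (α * u + (2 - α) * v) - ℓ (u + v)) +
      w' * (ℓ (α * v + (2 - α) * u) - ℓ (v + u)) := by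
  have h1 : ℓ (u + v) ≤ ℓ (α * u + (2 - α) * v) := hanti (by nlinarith)
  have h2 := hconv.2 (Set.mem_univ (α * u + (2 - α) * v)) (Set.mem_univ (α * v + (2 - α) * u))
    (show (0 : ℝ) ≤ 1 / 2 by norm_num) (show (0 : ℝ) ≤ 1 / 2 by norm_num) (by norm_num)
  simp only [smul_eq_mul] at h2
  rw [show 1 / 2 * (α * u + (2 - α) * v) + 1 / 2 * (α * v + (2 - α) * u) = u + v by ring] at h2
  rw [add_comm v u]
  nlinarith [mul_nonneg (sub_nonneg.2 hw) (sub_nonneg.2 h1),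
    mul_nonneg hw' (show 0 ≤ ℓ (α * u + (2 - α) * v) + ℓ (α * v + (2 - α) * u) - 2 * ℓ (u + v)
      by linarith)]

/-- An antitone function bounded below is bounded, hence integrable, along a nonnegative map. -/
lemma integrable_antitone_comp_of_nonneg {Ω : Type*} [MeasurableSpace Ω] {μ : Measure Ω}
    [IsFiniteMeasure μ] {ℓ : ℝ → ℝ} (hanti : Antitone ℓ) {C : ℝ} (hC : ∀ x, C ≤ ℓ x)
    {f : Ω → ℝ} (hf : Measurable f) (hf0 : ∀ x, 0 ≤ f x) :
    Integrable (fun x => ℓ (f x)) μ := by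
  refine .of_bound (hanti.measurable.comp hf).aestronglyMeasurable (max |C| |ℓ 0|)
    (.of_forall fun x => ?_)
  exact abs_le_max_abs_abs (hC _) (hanti (hf0 x))

/-- Among combinations `α |X|² + (2 - α) |Y|²` of independent centred isotropic Gaussian vectors,
where `X` has the larger variance, the balanced one minimizes a convex decreasing loss. -/
lemma integral_gaussian_loss_sub_nonneg {ι : Type*} [Fintype ι] {ℓ : ℝ → ℝ}
    (hconv : ConvexOn ℝ Set.univ ℓ) (hanti : Antitone ℓ) {C : ℝ} (hC : ∀ x, C ≤ ℓ x)
    {α : ℝ} (hα0 : 0 ≤ α) (hα1 : α ≤ 1) {a b : NNReal} (hb : b ≠ 0) (hba : b ≤ a) :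
    0 ≤ ∫ p : (ι → ℝ) × (ι → ℝ),
        (ℓ (α * (∑ j, p.1 j ^ 2) + (2 - α) * ∑ j, p.2 j ^ 2) -
          ℓ ((∑ j, p.1 j ^ 2) + ∑ j, p.2 j ^ 2))
      ∂((Measure.pi fun _ : ι => gaussianReal 0 a).prod
          (Measure.pi fun _ : ι => gaussianReal 0 b)) := by
  have hb0 : 0 < b := pos_iff_ne_zero.2 hb
  have ha0 : 0 < a := hb0.trans_le hba
  have hm (v : NNReal) : Measurable fun x : ι → ℝ => ∏ i, gaussianPDFReal 0 v (x i) :=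
    Finset.measurable_fun_prod _ fun i _ =>
      (measurable_gaussianPDFReal 0 v).comp (measurable_pi_apply i)
  have hi (v : NNReal) : Integrable fun x : ι → ℝ => ∏ i, gaussianPDFReal 0 v (x i) :=
    Integrable.fintype_prod fun _ => integrable_gaussianPDFReal 0 v
  have h0 (v : NNReal) (x : ι → ℝ) : 0 ≤ ∏ i, gaussianPDFReal 0 v (x i) :=
    Finset.prod_nonneg fun i _ => gaussianPDFReal_nonneg 0 v _
  rw [pi_gaussianReal_eq_withDensity ha0.ne', pi_gaussianReal_eq_withDensity hb,
    prod_withDensity (hm a).ennreal_ofReal (hm b).ennreal_ofReal,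
    integral_withDensity_eq_integral_toReal_smul
      (f := fun z : (ι → ℝ) × (ι → ℝ) => ENNReal.ofReal (∏ i, gaussianPDFReal 0 a (z.1 i)) *
        ENNReal.ofReal (∏ i, gaussianPDFReal 0 b (z.2 i)))
      (((hm a).ennreal_ofReal.comp measurable_fst).mul
        ((hm b).ennreal_ofReal.comp measurable_snd))
      (.of_forall fun _ => ENNReal.mul_lt_top ENNReal.ofReal_lt_top ENNReal.ofReal_lt_top)]
  simp only [ENNReal.toReal_mul, ENNReal.toReal_ofReal (h0 _ _), smul_eq_mul]
  have hsq (x : ι → ℝ) : 0 ≤ ∑ i, x i ^ 2 := Finset.sum_nonneg fun i _ => sq_nonneg _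
  refine integral_prod_nonneg_of_add_swap_nonneg ?_ ?_
  · refine ((hi a).mul_prod (hi b)).mul_bdd (c := ℓ 0 - C) ?_ (.of_forall fun p => ?_)
    · exact ((hanti.measurable.comp (by fun_prop)).sub
        (hanti.measurable.comp (by fun_prop))).aestronglyMeasurable
    · have hu := hsq p.1
      have hv := hsq p.2
      have h1 := hanti (show 0 ≤ α * (∑ j, p.1 j ^ 2) + (2 - α) * ∑ j, p.2 j ^ 2 by
        have := mul_nonneg hα0 hu
        have := mul_nonneg (show 0 ≤ 2 - α by linarith) hv
        linarith)
      have h2 := hanti (show 0 ≤ (∑ j, p.1 j ^ 2) + ∑ j, p.2 j ^ 2 by linarith)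
      rw [Real.norm_eq_abs, abs_le]
      constructor <;> linarith [hC (α * (∑ j, p.1 j ^ 2) + (2 - α) * ∑ j, p.2 j ^ 2),
        hC ((∑ j, p.1 j ^ 2) + ∑ j, p.2 j ^ 2)]
  · have key (x y : ι → ℝ) (h : ∑ i, y i ^ 2 ≤ ∑ i, x i ^ 2) :
        (∏ i, gaussianPDFReal 0 a (y i)) * ∏ i, gaussianPDFReal 0 b (x i) ≤
          (∏ i, gaussianPDFReal 0 a (x i)) * ∏ i, gaussianPDFReal 0 b (y i) := by
      simp only [prod_gaussianPDFReal]
      rw [mul_mul_mul_comm, mul_mul_mul_comm _ (Real.exp (-(∑ i, x i ^ 2) / (2 * a))),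
        ← Real.exp_add, ← Real.exp_add]
      refine mul_le_mul_of_nonneg_left (Real.exp_le_exp.2 ?_) (by positivity)
      have hinv : (2 * (a : ℝ))⁻¹ ≤ (2 * (b : ℝ))⁻¹ := by
        have : (b : ℝ) ≤ a := hba
        have : (0 : ℝ) < b := hb0
        gcongr
      simp only [div_eq_mul_inv]
      nlinarith [mul_nonneg (sub_nonneg.2 hinv) (sub_nonneg.2 h)]
    rintro ⟨x, y⟩
    simp only [Prod.swap_prod_mk]
    rcases le_total (∑ i, y i ^ 2) (∑ i, x i ^ 2) with h | h
    · exact convex_antitone_weighted_swap_nonneg hconv hanti hα1 h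
        (mul_nonneg (h0 _ _) (h0 _ _)) (key x y h)
    · rw [add_comm]
      exact convex_antitone_weighted_swap_nonneg hconv hanti hα1 h
        (mul_nonneg (h0 _ _) (h0 _ _)) (key y x h)

/-- For independent `χ²_s` variables `Z, Z₁`, a convex decreasing bounded-below loss `ℓ` and
`T ≥ 1`, the map `α ↦ E[ℓ(α Z + ((2-α)/T) Z₁)]` on `[0,1]` is minimized at `α = 1`. -/
theorem stmt_15 {s : ℕ} (hs : 1 ≤ s)
    (ℓ : ℝ → ℝ) (hconv : ConvexOn ℝ Set.univ ℓ) (hanti : Antitone ℓ)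
    (hbdd : BddBelow (Set.range ℓ))
    (T : ℝ) (hT : 1 ≤ T) (α : ℝ) (hα0 : 0 ≤ α) (hα1 : α ≤ 1) :
    ∫ p : (Fin s → ℝ) × (Fin s → ℝ),
        ℓ ((∑ j, p.1 j ^ 2) + 1 / T * ∑ j, p.2 j ^ 2)
      ∂((Measure.pi fun _ : Fin s => gaussianReal 0 1).prod
          (Measure.pi fun _ : Fin s => gaussianReal 0 1))
    ≤ ∫ p : (Fin s → ℝ) × (Fin s → ℝ),
        ℓ (α * (∑ j, p.1 j ^ 2) + (2 - α) / T * ∑ j, p.2 j ^ 2)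
      ∂((Measure.pi fun _ : Fin s => gaussianReal 0 1).prod
          (Measure.pi fun _ : Fin s => gaussianReal 0 1)) := by
  obtain ⟨C, hC⟩ := hbdd
  replace hC (x : ℝ) : C ≤ ℓ x := hC ⟨x, rfl⟩
  have hT0 : 0 < T := by linarith
  set P := Measure.pi fun _ : Fin s => gaussianReal 0 1 with hP
  set c : ℝ := √(1 / T)
  have hc2 : c ^ 2 = 1 / T := Real.sq_sqrt (by positivity)
  set b : NNReal := ⟨c ^ 2, sq_nonneg c⟩
  have hbT : (b : ℝ) = 1 / T := hc2
  have hb : b ≠ 0 := by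
    rw [← NNReal.coe_ne_zero, hbT]
    positivity
  have hb1 : b ≤ 1 := by
    rw [← NNReal.coe_le_coe, hbT, NNReal.coe_one, div_le_one hT0]
    exact hT
  have hg : (gaussianReal 0 1).map (c * ·) = gaussianReal 0 b := by
    rw [gaussianReal_map_const_mul, mul_zero, mul_one]
    rfl
  have hmap : P.map (fun x i => c * x i) = Measure.pi fun _ : Fin s => gaussianReal 0 b := by
    have : SigmaFinite ((gaussianReal 0 1).map (c * ·)) := by rw [hg]; infer_instance
    rw [hP, Measure.pi_map_pi (f := fun _ : Fin s => (c * ·)) fun _ => by fun_prop, hg]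
  have hmeas : Measurable fun x : Fin s → ℝ => fun i => c * x i := by fun_prop
  have key := integral_gaussian_loss_sub_nonneg (ι := Fin s) hconv hanti hC hα0 hα1 hb hb1
  have hprod : P.prod (P.map fun x i => c * x i) =
      (P.prod P).map (Prod.map id fun x i => c * x i) := by
    rw [← Measure.map_prod_map _ _ measurable_id hmeas, Measure.map_id]
  have hloss : Measurable fun p : (Fin s → ℝ) × (Fin s → ℝ) =>
      ℓ (α * (∑ j, p.1 j ^ 2) + (2 - α) * ∑ j, p.2 j ^ 2) -
        ℓ ((∑ j, p.1 j ^ 2) + ∑ j, p.2 j ^ 2) :=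
    (hanti.measurable.comp (by fun_prop)).sub (hanti.measurable.comp (by fun_prop))
  rw [← hmap, ← hP, hprod, integral_map (measurable_id.prodMap hmeas).aemeasurable
    hloss.aestronglyMeasurable] at key
  simp only [Prod.map_fst, Prod.map_snd, id_eq, mul_pow, ← Finset.mul_sum, hc2,
    ← mul_assoc, mul_one_div] at key
  have hsq (x : Fin s → ℝ) : 0 ≤ ∑ i, x i ^ 2 := Finset.sum_nonneg fun i _ => sq_nonneg _
  have h2α : 0 ≤ (2 - α) / T := div_nonneg (by linarith) hT0.le
  rw [integral_sub
    (integrable_antitone_comp_of_nonneg hanti hC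
      (f := fun p : (Fin s → ℝ) × (Fin s → ℝ) =>
        α * (∑ j, p.1 j ^ 2) + (2 - α) / T * ∑ j, p.2 j ^ 2)
      (by fun_prop) fun p => add_nonneg (mul_nonneg hα0 (hsq p.1)) (mul_nonneg h2α (hsq p.2)))
    (integrable_antitone_comp_of_nonneg hanti hC
      (f := fun p : (Fin s → ℝ) × (Fin s → ℝ) => (∑ j, p.1 j ^ 2) + 1 / T * ∑ j, p.2 j ^ 2)
      (by fun_prop) fun p => add_nonneg (hsq p.1) (mul_nonneg (by positivity) (hsq p.2)))] at key
  exact sub_nonneg.1 key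
end
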